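/- Let n ≥ 1, 0 < α < n, 0 < t < ∞, 1 < p < r < ∞ and 1 < q < s < ∞ satisfy α/n = 1/p − 1/r = 1/q − 1/s. Let Ω be homogeneous of degree zero, have mean value zero on S^{n−1}, and be a Lipschitz function. If b ∈ BMO(ℝ^n), then the commutator [b, T_{Ω,α}] is bounded from (E_p^q)_t(ℝ^n) to (E_r^s)_t(ℝ^n); more precisely there is a constant C, independent of b, f and t, such that ‖[b, T_{Ω,α}]f‖_{(E_r^s)_t} ≤ C ‖b‖_{BMO} ‖f‖_{(E_p^q)_t} for all f ∈ (E_p^q)_t(ℝ^n). -/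

import Mathlib

open MeasureTheory ENNReal Metric

noncomputable section

/-- The (closed) cube centered at `x` with side length `r`. -/
def cube {n : ℕ} (x : EuclideanSpace ℝ (Fin n)) (r : ℝ) : Set (EuclideanSpace ℝ (Fin n)) :=
  {y | ∀ i, |y i - x i| ≤ r / 2}

/-- The average `f_Q = |Q|⁻¹ ∫_Q f` of `f` over a set `Q`. -/
def setAvg {n : ℕ} (Q : Set (EuclideanSpace ℝ (Fin n))) (f : EuclideanSpace ℝ (Fin n) → ℝ) : ℝ :=
  (volume Q).toReal⁻¹ * ∫ y in Q, f y

/-- Slice norm of an `ℝ≥0∞`-valued function. -/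
def sliceNormE {n : ℕ} (p q t : ℝ) (g : EuclideanSpace ℝ (Fin n) → ℝ≥0∞) : ℝ≥0∞ :=
  (∫⁻ x, ((volume (cube x t))⁻¹ * ∫⁻ y in cube x t, g y ^ p) ^ (q / p)) ^ (1 / q)

/-- The slice space norm `‖f‖_{(E_p^q)_t}`. -/
def sliceNorm {n : ℕ} (p q t : ℝ) (f : EuclideanSpace ℝ (Fin n) → ℝ) : ℝ≥0∞ :=
  sliceNormE p q t fun y => ENNReal.ofReal |f y|

/-- Membership in the slice space `(E_p^q)_t(ℝⁿ)`. -/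
def MemSlice {n : ℕ} (p q t : ℝ) (f : EuclideanSpace ℝ (Fin n) → ℝ) : Prop :=
  Measurable f ∧ sliceNorm p q t f ≠ ∞

/-- The BMO seminorm, as a supremum over all cubes. -/
def bmoNorm {n : ℕ} (b : EuclideanSpace ℝ (Fin n) → ℝ) : ℝ≥0∞ :=
  ⨆ (x : EuclideanSpace ℝ (Fin n)) (r : ℝ) (_ : 0 < r),
    (volume (cube x r))⁻¹ * ∫⁻ y in cube x r, ENNReal.ofReal |b y - setAvg (cube x r) b|

/-- Membership in `BMO(ℝⁿ)`. -/
def MemBMO {n : ℕ} (b : EuclideanSpace ℝ (Fin n) → ℝ) : Prop :=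
  LocallyIntegrable b volume ∧ bmoNorm b ≠ ∞

/-- `Ω` is homogeneous of degree zero. -/
def HomogZero {n : ℕ} (Ω : EuclideanSpace ℝ (Fin n) → ℝ) : Prop :=
  ∀ lam : ℝ, 0 < lam → ∀ x : EuclideanSpace ℝ (Fin n), x ≠ 0 → Ω (lam • x) = Ω x

/-- `Ω` has mean value zero on the unit sphere. -/
def MeanZeroOnSphere {n : ℕ} (Ω : EuclideanSpace ℝ (Fin n) → ℝ) : Prop :=
  ∫ x : sphere (0 : EuclideanSpace ℝ (Fin n)) 1, Ω x
    ∂((volume : Measure (EuclideanSpace ℝ (Fin n))).toSphere) = 0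

/-- The fractional integral operator with rough kernel,
`T_{Ω,α} f (x) = ∫ Ω(x-y) |x-y|^{α-n} f(y) dy`. -/
def fracInt {n : ℕ} (Ω : EuclideanSpace ℝ (Fin n) → ℝ) (α : ℝ)
    (f : EuclideanSpace ℝ (Fin n) → ℝ) (x : EuclideanSpace ℝ (Fin n)) : ℝ :=
  ∫ y, Ω (x - y) * ‖x - y‖ ^ (α - n) * f y

/-- The commutator `[b, T_{Ω,α}] f = b ⬝ T_{Ω,α} f - T_{Ω,α}(b f)`. -/
def commutatorOp {n : ℕ} (Ω : EuclideanSpace ℝ (Fin n) → ℝ) (α : ℝ)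
    (b f : EuclideanSpace ℝ (Fin n) → ℝ) : EuclideanSpace ℝ (Fin n) → ℝ :=
  fun x => b x * fracInt Ω α f x - fracInt Ω α (fun y => b y * f y) x

/-- The fractional maximal operator `M_γ` (over cubes); `γ = 0` gives the
Hardy–Littlewood maximal operator. -/
def fracMax {n : ℕ} (γ : ℝ) (f : EuclideanSpace ℝ (Fin n) → ℝ)
    (x : EuclideanSpace ℝ (Fin n)) : ℝ≥0∞ :=
  ⨆ (z : EuclideanSpace ℝ (Fin n)) (r : ℝ) (_ : 0 < r) (_ : x ∈ cube z r),
    volume (cube z r) ^ (γ / n - 1) * ∫⁻ y in cube z r, ENNReal.ofReal |f y|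

/-- The Fefferman–Stein sharp maximal operator `M^♯`. -/
def sharpMax {n : ℕ} (f : EuclideanSpace ℝ (Fin n) → ℝ)
    (x : EuclideanSpace ℝ (Fin n)) : ℝ≥0∞ :=
  ⨆ (z : EuclideanSpace ℝ (Fin n)) (r : ℝ) (_ : 0 < r) (_ : x ∈ cube z r),
    (volume (cube z r))⁻¹ * ∫⁻ y in cube z r, ENNReal.ofReal |f y - setAvg (cube z r) f|

/-- The `L^p` norm. -/
def lpNorm {n : ℕ} (p : ℝ) (f : EuclideanSpace ℝ (Fin n) → ℝ) : ℝ≥0∞ :=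
  (∫⁻ x, ENNReal.ofReal |f x| ^ p) ^ (1 / p)

/-- The set of admissible Hölder–Lipschitz constants of order `β` for `b`. -/
def LipConstSet {n : ℕ} (β : ℝ) (b : EuclideanSpace ℝ (Fin n) → ℝ) : Set ℝ :=
  {C : ℝ | ∀ x y, |b x - b y| ≤ C * dist x y ^ β}

/-- Membership in the Lipschitz space `Lip_β(ℝⁿ)`. -/
def MemLip {n : ℕ} (β : ℝ) (b : EuclideanSpace ℝ (Fin n) → ℝ) : Prop :=
  (LipConstSet β b).Nonempty

/-- The `Lip_β` norm: the least admissible constant. -/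
def lipNorm {n : ℕ} (β : ℝ) (b : EuclideanSpace ℝ (Fin n) → ℝ) : ℝ :=
  sInf (LipConstSet β b)

section BallAverages

open Set Filter Topology

variable {n : ℕ}

/-- The volume of a sup-norm ball of radius `R` in `ℝⁿ`. -/
def ballVol (n : ℕ) (R : ℝ) : ℝ≥0∞ := ENNReal.ofReal ((2 * R) ^ n)

/-- The `L^u` average of `f` over the sup-norm ball of center `z` and radius `R`. -/
def ballAvg (u R : ℝ) (f : (Fin n → ℝ) → ℝ≥0∞) (z : Fin n → ℝ) : ℝ≥0∞ :=
  ((ballVol n R)⁻¹ * ∫⁻ y in closedBall z R, f y ^ u) ^ (1 / u)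

lemma volume_closedBall_eq_ballVol (z : Fin n → ℝ) {R : ℝ} (hR : 0 ≤ R) :
    volume (closedBall z R) = ballVol n R := by
  simp [ballVol, Real.volume_pi_closedBall z hR]

lemma ballVol_ne_zero {R : ℝ} (hR : 0 < R) : ballVol n R ≠ 0 := by
  have : 0 < (2 * R) ^ n := by positivity
  simpa [ballVol] using this

lemma ballVol_ne_top {R : ℝ} : ballVol n R ≠ ∞ := ENNReal.ofReal_ne_top

lemma ballVol_mul {c : ℝ} (hc : 0 ≤ c) (R : ℝ) :
    ballVol n (c * R) = ENNReal.ofReal (c ^ n) * ballVol n R := by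
  rw [ballVol, ballVol, ← ENNReal.ofReal_mul (by positivity)]
  congr 1
  ring

lemma ballVol_mono {R S : ℝ} (hR : 0 ≤ R) (h : R ≤ S) : ballVol n R ≤ ballVol n S :=
  ENNReal.ofReal_le_ofReal (by gcongr)

lemma measurable_ballVol : Measurable (ballVol n) := by
  unfold ballVol; fun_prop

lemma ballVol_inv_mul_cancel {R : ℝ} (hR : 0 < R) : (ballVol n R)⁻¹ * ballVol n R = 1 :=
  ENNReal.inv_mul_cancel (ballVol_ne_zero hR) ballVol_ne_top

lemma setLIntegral_closedBall_eq (f : (Fin n → ℝ) → ℝ≥0∞) (z : Fin n → ℝ) (R : ℝ) :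
    ∫⁻ y in closedBall z R, f y = ∫⁻ y, {y | dist y z ≤ R}.indicator f y :=
  (lintegral_indicator measurableSet_closedBall f).symm

lemma measurable_setLIntegral_closedBall {β : Type*} [MeasurableSpace β]
    {F : β → (Fin n → ℝ) → ℝ≥0∞} (hF : Measurable (Function.uncurry F))
    {c : β → Fin n → ℝ} {ρ : β → ℝ} (hc : Measurable c) (hρ : Measurable ρ) :
    Measurable fun b => ∫⁻ y in closedBall (c b) (ρ b), F b y := by
  have hs : MeasurableSet {p : β × (Fin n → ℝ) | dist p.2 (c p.1) ≤ ρ p.1} :=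
    measurableSet_le (measurable_snd.dist (hc.comp measurable_fst)) (hρ.comp measurable_fst)
  have := (hF.indicator hs).lintegral_prod_right' (ν := (volume : Measure (Fin n → ℝ)))
  convert this using 2 with b
  rw [setLIntegral_closedBall_eq]
  rfl

lemma measurable_ballAvg {β : Type*} [MeasurableSpace β] (u : ℝ) {f : (Fin n → ℝ) → ℝ≥0∞}
    (hf : Measurable f) {c : β → Fin n → ℝ} {ρ : β → ℝ} (hc : Measurable c) (hρ : Measurable ρ) :
    Measurable fun b => ballAvg u (ρ b) f (c b) := by
  have h1 := measurable_setLIntegral_closedBall (F := fun _ y => f y ^ u)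
    ((hf.pow_const u).comp measurable_snd) hc hρ
  exact (((measurable_ballVol.comp hρ).inv.mul h1).pow_const _)

lemma setLIntegral_closedBall_swap_le {F : (Fin n → ℝ) → (Fin n → ℝ) → ℝ≥0∞}
    (hF : Measurable (Function.uncurry F)) (z : Fin n → ℝ) (R τ : ℝ) :
    ∫⁻ y in closedBall z R, ∫⁻ x in closedBall y τ, F y x ≤
      ∫⁻ x in closedBall z (R + τ), ∫⁻ y in closedBall x τ, F y x := by
  have hs : MeasurableSet {p : (Fin n → ℝ) × (Fin n → ℝ) | dist p.1 z ≤ R ∧ dist p.2 p.1 ≤ τ} :=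
    (measurableSet_le (f := fun p : (Fin n → ℝ) × (Fin n → ℝ) => dist p.1 z) (g := fun _ => R)
      (by fun_prop) (by fun_prop)).inter
    (measurableSet_le (f := fun p : (Fin n → ℝ) × (Fin n → ℝ) => dist p.2 p.1) (g := fun _ => τ)
      (by fun_prop) (by fun_prop))
  calc ∫⁻ y in closedBall z R, ∫⁻ x in closedBall y τ, F y x
      = ∫⁻ y, ∫⁻ x, {p : (Fin n → ℝ) × (Fin n → ℝ) | dist p.1 z ≤ R ∧ dist p.2 p.1 ≤ τ}.indicator
          (Function.uncurry F) (y, x) := by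
        rw [setLIntegral_closedBall_eq]
        refine lintegral_congr fun y => ?_
        by_cases hy : dist y z ≤ R
        · rw [indicator_of_mem (by exact hy), setLIntegral_closedBall_eq]
          simp [indicator, hy]
        · rw [indicator_of_notMem (by exact hy)]
          simp [indicator, hy]
    _ = ∫⁻ x, ∫⁻ y, {p : (Fin n → ℝ) × (Fin n → ℝ) | dist p.1 z ≤ R ∧ dist p.2 p.1 ≤ τ}.indicator
          (Function.uncurry F) (y, x) :=
        lintegral_lintegral_swap (hF.indicator hs).aemeasurable
    _ ≤ ∫⁻ x, {x | dist x z ≤ R + τ}.indicator (fun x => ∫⁻ y in closedBall x τ, F y x) x := by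
        refine lintegral_mono fun x => ?_
        by_cases hx : dist x z ≤ R + τ
        · rw [indicator_of_mem (by exact hx), setLIntegral_closedBall_eq]
          refine lintegral_mono fun y => ?_
          exact indicator_le_indicator_of_subset (f := fun y => F y x)
            (s := {y | dist y z ≤ R ∧ dist x y ≤ τ}) (t := {y | dist y x ≤ τ})
            (fun y hy => by simpa [dist_comm] using hy.2) (fun _ => zero_le) y
        · rw [indicator_of_notMem (by exact hx)]
          refine (lintegral_eq_zero_of_ae_eq_zero (Eventually.of_forall fun y => ?_)).le
          refine indicator_of_notMem ?_ _
          rintro ⟨h1, h2⟩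
          exact hx (by linarith [dist_triangle x y z])
    _ = _ := (setLIntegral_closedBall_eq _ _ _).symm

lemma lintegral_closedBall_swap {F : (Fin n → ℝ) → (Fin n → ℝ) → ℝ≥0∞}
    (hF : Measurable (Function.uncurry F)) (R : ℝ) :
    ∫⁻ y, ∫⁻ x in closedBall y R, F y x = ∫⁻ x, ∫⁻ y in closedBall x R, F y x := by
  have hs : MeasurableSet {p : (Fin n → ℝ) × (Fin n → ℝ) | dist p.2 p.1 ≤ R} :=
    measurableSet_le (by fun_prop) (by fun_prop)
  have := lintegral_lintegral_swap (μ := (volume : Measure (Fin n → ℝ)))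
    (ν := (volume : Measure (Fin n → ℝ)))
    (f := fun y x => {p : (Fin n → ℝ) × (Fin n → ℝ) | dist p.2 p.1 ≤ R}.indicator
      (Function.uncurry F) (y, x)) (hF.indicator hs).aemeasurable
  simp_rw [setLIntegral_closedBall_eq]
  refine this.trans (lintegral_congr fun x => lintegral_congr fun y => ?_)
  simp [indicator, dist_comm]

lemma lintegral_setLIntegral_closedBall {f : (Fin n → ℝ) → ℝ≥0∞} (hf : Measurable f) {R : ℝ}
    (hR : 0 ≤ R) : ∫⁻ z, ∫⁻ y in closedBall z R, f y = ballVol n R * ∫⁻ y, f y := by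
  rw [lintegral_closedBall_swap (F := fun _ y => f y) (hf.comp measurable_snd),
    ← lintegral_const_mul _ hf]
  simp [volume_closedBall_eq_ballVol _ hR, mul_comm]

lemma setLIntegral_closedBall_le_avg {f : (Fin n → ℝ) → ℝ≥0∞} (hf : Measurable f)
    (z : Fin n → ℝ) (R : ℝ) {τ : ℝ} (hτ : 0 < τ) :
    ∫⁻ y in closedBall z R, f y ≤
      ∫⁻ w in closedBall z (R + τ), (ballVol n τ)⁻¹ * ∫⁻ y in closedBall w τ, f y := by
  calc ∫⁻ y in closedBall z R, f y
      = ∫⁻ y in closedBall z R, ∫⁻ _ in closedBall y τ, (ballVol n τ)⁻¹ * f y := by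
        refine lintegral_congr fun y => ?_
        rw [setLIntegral_const, volume_closedBall_eq_ballVol _ hτ.le, mul_right_comm,
          ballVol_inv_mul_cancel hτ, one_mul]
    _ ≤ ∫⁻ w in closedBall z (R + τ), ∫⁻ y in closedBall w τ, (ballVol n τ)⁻¹ * f y :=
        setLIntegral_closedBall_swap_le (F := fun y _ => (ballVol n τ)⁻¹ * f y)
          ((hf.comp measurable_fst).const_mul _) z R τ
    _ = _ := by simp_rw [lintegral_const_mul _ hf]

lemma ballAvg_eq_eLpNorm' (u R : ℝ) (f : (Fin n → ℝ) → ℝ≥0∞) (z : Fin n → ℝ) :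
    ballAvg u R f z = eLpNorm' f u ((ballVol n R)⁻¹ • volume.restrict (closedBall z R)) := by
  simp [ballAvg, eLpNorm', lintegral_smul_measure]

lemma ballAvg_mono_exponent {u v R : ℝ} (hu : 0 < u) (huv : u ≤ v) (hR : 0 < R)
    {f : (Fin n → ℝ) → ℝ≥0∞} (hf : Measurable f) (z : Fin n → ℝ) :
    ballAvg u R f z ≤ ballAvg v R f z := by
  have : IsProbabilityMeasure ((ballVol n R)⁻¹ • volume.restrict (closedBall z R)) :=
    ⟨by simp [volume_closedBall_eq_ballVol z hR.le, ballVol_inv_mul_cancel hR]⟩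
  rw [ballAvg_eq_eLpNorm', ballAvg_eq_eLpNorm']
  exact eLpNorm'_le_eLpNorm'_of_exponent_le hu huv _ hf.aestronglyMeasurable

lemma ballAvg_mono {u R : ℝ} (hu : 0 < u) {f g : (Fin n → ℝ) → ℝ≥0∞} (h : ∀ y, f y ≤ g y)
    (z : Fin n → ℝ) : ballAvg u R f z ≤ ballAvg u R g z := by
  unfold ballAvg
  gcongr with y
  exact h y

lemma ballAvg_rpow {u : ℝ} (hu : 0 < u) (R : ℝ) (f : (Fin n → ℝ) → ℝ≥0∞) (z : Fin n → ℝ) :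
    ballAvg u R f z ^ u = (ballVol n R)⁻¹ * ∫⁻ y in closedBall z R, f y ^ u := by
  rw [ballAvg, ← ENNReal.rpow_mul, one_div_mul_cancel hu.ne', ENNReal.rpow_one]

lemma setLIntegral_rpow_eq_ballAvg {u R : ℝ} (hu : 0 < u) (hR : 0 < R)
    (f : (Fin n → ℝ) → ℝ≥0∞) (z : Fin n → ℝ) :
    ∫⁻ y in closedBall z R, f y ^ u = ballVol n R * ballAvg u R f z ^ u := by
  rw [ballAvg_rpow hu, ← mul_assoc, ENNReal.mul_inv_cancel (ballVol_ne_zero hR) ballVol_ne_top,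
    one_mul]

lemma setLIntegral_mul_le_ballAvg {u v R : ℝ} (huv : u.HolderConjugate v) (hR : 0 < R)
    {f g : (Fin n → ℝ) → ℝ≥0∞} (hf : Measurable f) (hg : Measurable g) (z : Fin n → ℝ) :
    ∫⁻ y in closedBall z R, f y * g y ≤ ballVol n R * ballAvg u R f z * ballAvg v R g z := by
  refine (ENNReal.lintegral_mul_le_Lp_mul_Lq _ huv hf.aemeasurable hg.aemeasurable).trans_eq ?_
  rw [setLIntegral_rpow_eq_ballAvg huv.pos hR, setLIntegral_rpow_eq_ballAvg huv.symm.pos hR,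
    ENNReal.mul_rpow_of_nonneg _ _ (by have := huv.pos; positivity),
    ENNReal.mul_rpow_of_nonneg _ _ (by have := huv.symm.pos; positivity),
    ← ENNReal.rpow_mul, ← ENNReal.rpow_mul, mul_one_div_cancel huv.pos.ne',
    mul_one_div_cancel huv.symm.pos.ne', ENNReal.rpow_one, ENNReal.rpow_one,
    mul_mul_mul_comm, ← ENNReal.rpow_add _ _ (ballVol_ne_zero hR) ballVol_ne_top, one_div, one_div,
    huv.inv_add_inv_eq_one, ENNReal.rpow_one, mul_assoc]

lemma setLIntegral_le_ballAvg {u R : ℝ} (hu : 1 ≤ u) (hR : 0 < R)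
    {f : (Fin n → ℝ) → ℝ≥0∞} (hf : Measurable f) (z : Fin n → ℝ) :
    ∫⁻ y in closedBall z R, f y ≤ ballVol n R * ballAvg u R f z := by
  have h := setLIntegral_rpow_eq_ballAvg one_pos hR f z
  simp only [ENNReal.rpow_one] at h
  rw [h]
  gcongr
  exact ballAvg_mono_exponent one_pos hu hR hf z

lemma ballAvg_le_of_subset {u R S c : ℝ} (hu : 0 < u) (hR : 0 < R) (hRS : R ≤ S) (hc : 0 ≤ c)
    (hS : S ≤ c * R) (f : (Fin n → ℝ) → ℝ≥0∞) (z : Fin n → ℝ) :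
    ballAvg u R f z ≤ ENNReal.ofReal (c ^ n) ^ (1 / u) * ballAvg u S f z := by
  rw [ballAvg, ballAvg, ← ENNReal.mul_rpow_of_nonneg _ _ (by positivity), ← mul_assoc]
  gcongr
  have h : ballVol n S ≤ ENNReal.ofReal (c ^ n) * ballVol n R := by
    rw [← ballVol_mul hc]; exact ballVol_mono (hR.le.trans hRS) hS
  calc (ballVol n R)⁻¹ = (ballVol n R)⁻¹ * ((ballVol n S)⁻¹ * ballVol n S) := by
        rw [ballVol_inv_mul_cancel (hR.trans_le hRS), mul_one]
    _ ≤ (ballVol n R)⁻¹ * ((ballVol n S)⁻¹ * (ENNReal.ofReal (c ^ n) * ballVol n R)) := by gcongr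
    _ = ((ballVol n R)⁻¹ * ballVol n R) * (ENNReal.ofReal (c ^ n) * (ballVol n S)⁻¹) := by ring
    _ = _ := by rw [ballVol_inv_mul_cancel hR, one_mul]

end BallAverages

section MaximalFunction

open Set Filter Topology

variable {n : ℕ}

lemma exists_countable_enlargement_cover {s T : Set (Fin n → ℝ)} {r : (Fin n → ℝ) → ℝ} {S : ℝ}
    (h0 : ∀ x ∈ s, 0 < r x) (hS : ∀ x ∈ s, r x ≤ S) {f : (Fin n → ℝ) → ℝ≥0∞} {K : ℝ≥0∞}
    (hK : ∀ x ∈ s, K * ballVol n (r x) ≤ ∫⁻ y in closedBall x (r x), f y)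
    (hT : ∀ x ∈ s, closedBall x (r x) ⊆ T) :
    ∃ u ⊆ s, u.Countable ∧ (s ⊆ ⋃ x ∈ u, closedBall x (5 * r x)) ∧
      K * ∑' x : u, ballVol n (5 * r x) ≤ ENNReal.ofReal (5 ^ n) * ∫⁻ y in T, f y := by
  obtain ⟨u, hus, hd, hcov⟩ := Vitali.exists_disjoint_subfamily_covering_enlargement_closedBall
    s id r S hS 5 (by norm_num)
  have hu : u.Countable := hd.countable_of_nonempty_interior fun x hx =>
    ⟨x, ball_subset_interior_closedBall (mem_ball_self (h0 x (hus hx)))⟩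
  refine ⟨u, hus, hu, fun x hx => ?_, ?_⟩
  · obtain ⟨y, hy, hxy⟩ := hcov x hx
    exact mem_iUnion₂.2 ⟨y, hy, hxy (mem_closedBall_self (h0 x hx).le)⟩
  · calc K * ∑' x : u, ballVol n (5 * r x)
        = ENNReal.ofReal (5 ^ n) * ∑' x : u, K * ballVol n (r x) := by
          simp_rw [ballVol_mul (by norm_num : (0 : ℝ) ≤ 5), ENNReal.tsum_mul_left]
          ring
      _ ≤ ENNReal.ofReal (5 ^ n) * ∑' x : u, ∫⁻ y in closedBall (x : Fin n → ℝ) (r x), f y := by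
          gcongr with x
          exact hK x (hus x.2)
      _ = ENNReal.ofReal (5 ^ n) * ∫⁻ y in ⋃ x ∈ u, closedBall x (r x), f y := by
          rw [lintegral_biUnion hu (fun _ _ => measurableSet_closedBall) (by exact hd)]
      _ ≤ _ := by
          gcongr
          exact iUnion₂_subset fun x hx => hT x (hus hx)

/-- The centered Hardy–Littlewood maximal function over sup-norm balls of dyadic radii. -/
def maximalFn (f : (Fin n → ℝ) → ℝ≥0∞) (x : Fin n → ℝ) : ℝ≥0∞ :=
  ⨆ k : ℤ, (ballVol n (2 ^ k))⁻¹ * ∫⁻ y in closedBall x (2 ^ k), f y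

lemma measurable_maximalFn {f : (Fin n → ℝ) → ℝ≥0∞} (hf : Measurable f) :
    Measurable (maximalFn f) :=
  .iSup fun _ => (measurable_setLIntegral_closedBall (F := fun _ y => f y)
    (hf.comp measurable_snd) measurable_id measurable_const).const_mul _

lemma ballAvg_le_maximalFn {u R : ℝ} (hu : 0 < u) (hR : 0 < R) (f : (Fin n → ℝ) → ℝ≥0∞)
    (z : Fin n → ℝ) : ballAvg u R f z ≤
      ENNReal.ofReal (2 ^ n) ^ (1 / u) * maximalFn (fun y => f y ^ u) z ^ (1 / u) := by
  obtain ⟨k, hk1, hk2⟩ := exists_mem_Ioc_zpow hR one_lt_two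
  refine (ballAvg_le_of_subset hu hR hk2 zero_le_two ?_ f z).trans ?_
  · rw [zpow_add_one₀ two_ne_zero]; linarith
  · gcongr
    rw [ballAvg]
    gcongr
    exact le_iSup (fun k : ℤ => (ballVol n (2 ^ k))⁻¹ * ∫⁻ y in closedBall z (2 ^ k), f y ^ u) _

lemma mul_volume_lt_maximalFn_le (hn : n ≠ 0) (f : (Fin n → ℝ) → ℝ≥0∞) {l : ℝ} (hl : 0 < l) :
    ENNReal.ofReal l * volume {x | ENNReal.ofReal l < maximalFn f x} ≤
      ENNReal.ofReal (5 ^ n) * ∫⁻ y, f y := by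
  by_cases hI : ∫⁻ y, f y = ∞
  · rw [hI, ENNReal.mul_top (by simp)]
    exact le_top
  have hex : ∀ x, ∃ r : ℝ, x ∈ {x | ENNReal.ofReal l < maximalFn f x} →
      0 < r ∧ ENNReal.ofReal l * ballVol n r ≤ ∫⁻ y in closedBall x r, f y := by
    intro x
    by_cases hx : ENNReal.ofReal l < maximalFn f x
    · obtain ⟨k, hk⟩ := lt_iSup_iff.1 hx
      have h2 : (0 : ℝ) < 2 ^ k := by positivity
      refine ⟨2 ^ k, fun _ => ⟨h2, ?_⟩⟩
      rw [← ENNReal.div_eq_inv_mul] at hk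
      exact (ENNReal.le_div_iff_mul_le (Or.inl (ballVol_ne_zero h2)) (Or.inl ballVol_ne_top)).1
        hk.le
    · exact ⟨0, fun h => (hx h).elim⟩
  choose r hr using hex
  have hbd : ∀ x ∈ {x | ENNReal.ofReal l < maximalFn f x},
      r x ≤ max 1 ((∫⁻ y, f y).toReal / l) := by
    intro x hx
    obtain ⟨h0, h1⟩ := hr x hx
    by_cases hx1 : r x ≤ 1
    · exact hx1.trans (le_max_left _ _)
    · refine le_max_of_le_right ?_
      rw [le_div_iff₀ hl]
      have h2 := h1.trans (setLIntegral_le_lintegral _ _)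
      rw [ballVol, ← ENNReal.ofReal_mul hl.le, ENNReal.ofReal_le_iff_le_toReal hI] at h2
      have h3 : 2 * r x ≤ (2 * r x) ^ n := le_self_pow₀ (by linarith) hn
      nlinarith
  obtain ⟨u, hus, hu, hcov, hsum⟩ := exists_countable_enlargement_cover (T := univ)
    (fun x hx => (hr x hx).1) hbd (fun x hx => (hr x hx).2) (fun _ _ => subset_univ _)
  rw [Measure.restrict_univ] at hsum
  refine le_trans ?_ hsum
  gcongr
  refine (measure_mono hcov).trans ((measure_biUnion_le _ hu _).trans_eq ?_)
  refine tsum_congr fun x => volume_closedBall_eq_ballVol _ ?_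
  have := (hr x (hus x.2)).1
  positivity

lemma lintegral_Ioi_rpow_indicator (x : ℝ≥0∞) {p : ℝ} (hp : 0 < p) :
    ENNReal.ofReal p * ∫⁻ l in Ioi (0 : ℝ),
      {l : ℝ | ENNReal.ofReal l < x}.indicator (fun l => ENNReal.ofReal (l ^ (p - 1))) l
      = x ^ p := by
  have hfin : ∀ a : ℝ, 0 ≤ a → ENNReal.ofReal p * ∫⁻ l in Ioi (0 : ℝ),
      {l : ℝ | ENNReal.ofReal l < ENNReal.ofReal a}.indicator
        (fun l => ENNReal.ofReal (l ^ (p - 1))) l = ENNReal.ofReal a ^ p := by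
    intro a ha
    have := lintegral_rpow_eq_lintegral_meas_lt_mul (Measure.dirac (0 : ℝ)) (f := fun _ => a)
      (Eventually.of_forall fun _ => ha) aemeasurable_const hp
    rw [lintegral_dirac] at this
    rw [ENNReal.ofReal_rpow_of_nonneg ha hp.le, this]
    congr 1
    refine setLIntegral_congr_fun measurableSet_Ioi fun l hl => ?_
    by_cases h : l < a
    · simp [h, indicator, ENNReal.ofReal_lt_ofReal_iff_of_nonneg (le_of_lt hl)]
    · simp [h, indicator, ENNReal.ofReal_lt_ofReal_iff_of_nonneg (le_of_lt hl)]
  by_cases hx : x = ∞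
  · subst hx
    rw [ENNReal.top_rpow_of_pos hp, eq_top_iff]
    refine ENNReal.le_of_forall_nnreal_lt fun a _ => ?_
    have h := hfin (a ^ (1 / p)) (by positivity)
    rw [ENNReal.ofReal_rpow_of_nonneg (by positivity) hp.le, ← Real.rpow_mul a.coe_nonneg,
      one_div_mul_cancel hp.ne', Real.rpow_one, ENNReal.ofReal_coe_nnreal] at h
    rw [← h]
    refine mul_le_mul_right (lintegral_mono fun l => ?_) _
    exact indicator_le_indicator_of_subset (f := fun l : ℝ => ENNReal.ofReal (l ^ (p - 1)))
      (fun l _ => ENNReal.ofReal_lt_top) (fun _ => zero_le) l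
  · rw [← ENNReal.ofReal_toReal hx]
    exact hfin _ ENNReal.toReal_nonneg

lemma maximalFn_le_add (f : (Fin n → ℝ) → ℝ≥0∞) (c : ℝ≥0∞) (x : Fin n → ℝ) :
    maximalFn f x ≤ c + maximalFn ({y | c < f y}.indicator f) x := by
  refine iSup_le fun k => ?_
  have h2 : (0 : ℝ) < 2 ^ k := by positivity
  calc (ballVol n (2 ^ k))⁻¹ * ∫⁻ y in closedBall x (2 ^ k), f y
      ≤ (ballVol n (2 ^ k))⁻¹ * ∫⁻ y in closedBall x (2 ^ k), (c + {y | c < f y}.indicator f y) := by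
        gcongr with y
        by_cases hy : c < f y
        · rw [indicator_of_mem (by exact hy)]; exact le_add_self
        · exact (not_lt.1 hy).trans le_self_add
    _ = c + (ballVol n (2 ^ k))⁻¹ * ∫⁻ y in closedBall x (2 ^ k), {y | c < f y}.indicator f y := by
        rw [lintegral_add_left measurable_const, setLIntegral_const,
          volume_closedBall_eq_ballVol _ h2.le, mul_add, mul_left_comm, ballVol_inv_mul_cancel h2,
          mul_one]
    _ ≤ _ := by
        gcongr
        exact le_iSup (fun k : ℤ => (ballVol n (2 ^ k))⁻¹ *
          ∫⁻ y in closedBall x (2 ^ k), {y | c < f y}.indicator f y) k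

lemma lintegral_maximalFn_rpow_le (hn : n ≠ 0) {p : ℝ} (hp : 1 < p) :
    ∃ C : ℝ≥0∞, C ≠ ∞ ∧ ∀ f : (Fin n → ℝ) → ℝ≥0∞, Measurable f →
      ∫⁻ x, maximalFn f x ^ p ≤ C * ∫⁻ x, f x ^ p := by
  have hp0 : 0 < p := by linarith
  have hp1 : 0 < p - 1 := by linarith
  refine ⟨ENNReal.ofReal p * (ENNReal.ofReal (5 ^ n) * 2 * ((ENNReal.ofReal (p - 1))⁻¹ *
    2 ^ (p - 1))), by finiteness, fun f hf => ?_⟩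
  have hM := measurable_maximalFn hf
  have hs : MeasurableSet {q : (Fin n → ℝ) × ℝ | ENNReal.ofReal q.2 < maximalFn f q.1} :=
    measurableSet_lt (by fun_prop) (hM.comp measurable_fst)
  have hs' : MeasurableSet {q : ℝ × (Fin n → ℝ) | ENNReal.ofReal q.1 < 2 * f q.2} :=
    measurableSet_lt (by fun_prop) ((hf.comp measurable_snd).const_mul _)
  have hw : ∀ l : ℝ, 0 < l → volume {x | ENNReal.ofReal l < maximalFn f x} ≤
      ENNReal.ofReal (5 ^ n) * 2 * ENNReal.ofReal (l⁻¹) *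
        ∫⁻ x, {x | ENNReal.ofReal l < 2 * f x}.indicator f x := by
    intro l hl
    have hsplit : ENNReal.ofReal l = ENNReal.ofReal (l / 2) + ENNReal.ofReal (l / 2) := by
      rw [← ENNReal.ofReal_add (by positivity) (by positivity), add_halves]
    have hset : {x | ENNReal.ofReal l < 2 * f x} = {x | ENNReal.ofReal (l / 2) < f x} := by
      ext x
      rw [mem_ofPred_eq, mem_ofPred_eq, ENNReal.ofReal_div_of_pos two_pos,
        ENNReal.ofReal_ofNat, ENNReal.div_lt_iff (by simp) (by simp), mul_comm]
    have h1 := mul_volume_lt_maximalFn_le hn ({x | ENNReal.ofReal (l / 2) < f x}.indicator f)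
      (half_pos hl)
    rw [hset]
    calc volume {x | ENNReal.ofReal l < maximalFn f x}
        ≤ volume {x | ENNReal.ofReal (l / 2) <
            maximalFn ({x | ENNReal.ofReal (l / 2) < f x}.indicator f) x} := by
          refine measure_mono fun x hx => ?_
          have := lt_of_lt_of_le hx (maximalFn_le_add f (ENNReal.ofReal (l / 2)) x)
          rw [hsplit] at this
          exact (ENNReal.add_lt_add_iff_left ENNReal.ofReal_ne_top).1 this
      _ = ENNReal.ofReal (2 * l⁻¹) * (ENNReal.ofReal (l / 2) * volume {x | ENNReal.ofReal (l / 2) <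
            maximalFn ({x | ENNReal.ofReal (l / 2) < f x}.indicator f) x}) := by
          rw [← mul_assoc, ← ENNReal.ofReal_mul (by positivity)]
          field_simp
          simp
      _ ≤ ENNReal.ofReal (2 * l⁻¹) * (ENNReal.ofReal (5 ^ n) *
            ∫⁻ x, {x | ENNReal.ofReal (l / 2) < f x}.indicator f x) := by gcongr
      _ = _ := by
          rw [ENNReal.ofReal_mul zero_le_two, ENNReal.ofReal_ofNat]; ring
  calc ∫⁻ x, maximalFn f x ^ p
      = ENNReal.ofReal p * ∫⁻ x, ∫⁻ l in Ioi (0 : ℝ),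
          {q : (Fin n → ℝ) × ℝ | ENNReal.ofReal q.2 < maximalFn f q.1}.indicator
            (fun q => ENNReal.ofReal (q.2 ^ (p - 1))) (x, l) := by
        rw [← lintegral_const_mul']
        · refine lintegral_congr fun x => ?_
          rw [← lintegral_Ioi_rpow_indicator _ hp0]
          rfl
        · exact ENNReal.ofReal_ne_top
    _ = ENNReal.ofReal p * ∫⁻ l in Ioi (0 : ℝ), ∫⁻ x,
          {q : (Fin n → ℝ) × ℝ | ENNReal.ofReal q.2 < maximalFn f q.1}.indicator
            (fun q => ENNReal.ofReal (q.2 ^ (p - 1))) (x, l) := by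
        rw [lintegral_lintegral_swap]
        exact (Measurable.indicator (by fun_prop) hs).aemeasurable
    _ ≤ ENNReal.ofReal p * ∫⁻ l in Ioi (0 : ℝ), ENNReal.ofReal (5 ^ n) * 2 * ∫⁻ x,
          {q : ℝ × (Fin n → ℝ) | ENNReal.ofReal q.1 < 2 * f q.2}.indicator
            (fun q => ENNReal.ofReal (q.1 ^ (p - 1 - 1)) * f q.2) (l, x) := by
        gcongr ENNReal.ofReal p * ?_
        refine setLIntegral_mono' measurableSet_Ioi fun l hl => ?_
        calc ∫⁻ x, {q : (Fin n → ℝ) × ℝ | ENNReal.ofReal q.2 < maximalFn f q.1}.indicator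
              (fun q => ENNReal.ofReal (q.2 ^ (p - 1))) (x, l)
            = ENNReal.ofReal (l ^ (p - 1)) * volume {x | ENNReal.ofReal l < maximalFn f x} := by
              rw [← lintegral_indicator_const (measurableSet_lt measurable_const hM)]
              rfl
          _ ≤ ENNReal.ofReal (l ^ (p - 1)) * (ENNReal.ofReal (5 ^ n) * 2 * ENNReal.ofReal (l⁻¹) *
                ∫⁻ x, {x | ENNReal.ofReal l < 2 * f x}.indicator f x) := by
              gcongr; exact hw l hl
          _ = ENNReal.ofReal (5 ^ n) * 2 * (ENNReal.ofReal (l ^ (p - 1 - 1)) *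
                ∫⁻ x, {x | ENNReal.ofReal l < 2 * f x}.indicator f x) := by
              rw [Real.rpow_sub_one (ne_of_gt hl) (p - 1), div_eq_mul_inv,
                ENNReal.ofReal_mul (Real.rpow_nonneg (le_of_lt hl) _)]
              ring
          _ = _ := by
              rw [← lintegral_const_mul' _ _ ENNReal.ofReal_ne_top]
              congr 1
              refine lintegral_congr fun x => ?_
              by_cases hx : ENNReal.ofReal l < 2 * f x <;> simp [indicator, hx]
    _ = ENNReal.ofReal p * (ENNReal.ofReal (5 ^ n) * 2 * ∫⁻ x, ∫⁻ l in Ioi (0 : ℝ),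
          {q : ℝ × (Fin n → ℝ) | ENNReal.ofReal q.1 < 2 * f q.2}.indicator
            (fun q => ENNReal.ofReal (q.1 ^ (p - 1 - 1)) * f q.2) (l, x)) := by
        rw [lintegral_const_mul' _ _ (by finiteness), lintegral_lintegral_swap]
        refine (Measurable.indicator ?_ hs').aemeasurable
        exact (ENNReal.measurable_ofReal.comp (by fun_prop)).mul (hf.comp measurable_snd)
    _ = ENNReal.ofReal p * (ENNReal.ofReal (5 ^ n) * 2 * ∫⁻ x, (ENNReal.ofReal (p - 1))⁻¹ *
          2 ^ (p - 1) * f x ^ p) := by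
        congr 2
        refine lintegral_congr fun x => ?_
        have h1 := lintegral_Ioi_rpow_indicator (2 * f x) hp1
        have h2 : f x ^ p = f x ^ (p - 1) * f x := by
          conv_rhs => rw [← ENNReal.rpow_one (f x), ← ENNReal.rpow_mul, one_mul,
            ← ENNReal.rpow_add_of_nonneg _ _ hp1.le zero_le_one, sub_add_cancel]
        calc ∫⁻ l in Ioi (0 : ℝ), {q : ℝ × (Fin n → ℝ) | ENNReal.ofReal q.1 < 2 * f q.2}.indicator
              (fun q => ENNReal.ofReal (q.1 ^ (p - 1 - 1)) * f q.2) (l, x)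
            = ∫⁻ l in Ioi (0 : ℝ), {l : ℝ | ENNReal.ofReal l < 2 * f x}.indicator
                (fun l => ENNReal.ofReal (l ^ (p - 1 - 1))) l * f x := by
              refine lintegral_congr fun l => ?_
              by_cases hx : ENNReal.ofReal l < 2 * f x <;> simp [indicator, hx]
          _ = (∫⁻ l in Ioi (0 : ℝ), {l : ℝ | ENNReal.ofReal l < 2 * f x}.indicator
                (fun l => ENNReal.ofReal (l ^ (p - 1 - 1))) l) * f x :=
              lintegral_mul_const _ (Measurable.indicator (by fun_prop)
                (measurableSet_lt (by fun_prop) measurable_const))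
          _ = _ := by
              rw [h2, mul_assoc, ← mul_assoc (2 ^ (p - 1)),
                ← ENNReal.mul_rpow_of_nonneg _ _ hp1.le, ← h1, ← mul_assoc, ← mul_assoc,
                ENNReal.inv_mul_cancel (by simpa using hp) ENNReal.ofReal_ne_top, one_mul]
    _ = _ := by
        rw [lintegral_const_mul' _ _ (by finiteness)]
        ring

end MaximalFunction

section JohnNirenberg

open Set Filter Topology

variable {n : ℕ}

/-- The mean oscillation of `b` over every sup-norm ball is at most `N`. -/
def MeanOscLE (b : (Fin n → ℝ) → ℝ) (N : ℝ≥0∞) : Prop :=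
  ∀ z R, 0 < R → ∫⁻ y in closedBall z R, ‖b y - ⨍ w in closedBall z R, b w‖ₑ ≤ N * ballVol n R

lemma enorm_average_sub_le {b : (Fin n → ℝ) → ℝ} {z : Fin n → ℝ} {R : ℝ} (hR : 0 < R)
    (hb : IntegrableOn b (closedBall z R)) (c : ℝ) :
    ‖(⨍ w in closedBall z R, b w) - c‖ₑ ≤
      (ballVol n R)⁻¹ * ∫⁻ y in closedBall z R, ‖b y - c‖ₑ := by
  have hv := volume_closedBall_eq_ballVol z hR.le
  have hp : IsProbabilityMeasure ((ballVol n R)⁻¹ • volume.restrict (closedBall z R)) :=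
    ⟨by simp [hv, ballVol_inv_mul_cancel hR]⟩
  have hb' : Integrable b ((ballVol n R)⁻¹ • volume.restrict (closedBall z R)) :=
    Integrable.smul_measure hb (ENNReal.inv_ne_top.2 (ballVol_ne_zero hR))
  have h : (⨍ w in closedBall z R, b w) - c =
      ∫ w, (b w - c) ∂((ballVol n R)⁻¹ • volume.restrict (closedBall z R)) := by
    rw [integral_sub hb' (integrable_const _), average, Measure.restrict_apply_univ, hv]
    simp
  rw [h]
  refine (enorm_integral_le_lintegral_enorm _).trans_eq ?_
  rw [lintegral_smul_measure, smul_eq_mul]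

/-- The largest normalized measure of the set where `b` deviates from its average over a ball by
more than `l`. -/
def oscDistribution (b : (Fin n → ℝ) → ℝ) (l : ℝ≥0∞) : ℝ≥0∞ :=
  ⨆ (z : Fin n → ℝ) (R : ℝ) (_ : 0 < R), (ballVol n R)⁻¹ *
    volume (closedBall z R ∩ {x | l < ‖b x - ⨍ w in closedBall z R, b w‖ₑ})

lemma volume_osc_le (b : (Fin n → ℝ) → ℝ) (l : ℝ≥0∞) (z : Fin n → ℝ) {R : ℝ} (hR : 0 < R) :
    volume (closedBall z R ∩ {x | l < ‖b x - ⨍ w in closedBall z R, b w‖ₑ}) ≤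
      oscDistribution b l * ballVol n R := by
  have h : (ballVol n R)⁻¹ * volume (closedBall z R ∩
      {x | l < ‖b x - ⨍ w in closedBall z R, b w‖ₑ}) ≤ oscDistribution b l :=
    le_iSup_of_le z (le_iSup_of_le R (le_iSup_of_le hR le_rfl))
  rw [← ENNReal.div_eq_inv_mul] at h
  exact (ENNReal.div_le_iff_le_mul (Or.inl (ballVol_ne_zero hR)) (Or.inl ballVol_ne_top)).1 h

lemma oscDistribution_le_one (b : (Fin n → ℝ) → ℝ) (l : ℝ≥0∞) : oscDistribution b l ≤ 1 := by
  refine iSup_le fun z => iSup_le fun R => iSup_le fun hR => ?_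
  rw [← ballVol_inv_mul_cancel (n := n) hR, ← volume_closedBall_eq_ballVol z hR.le]
  gcongr
  exact inter_subset_left

/-- A constant controlling the oscillation over a doubled ball. -/
def doublingConst (n : ℕ) : ℝ≥0∞ := ENNReal.ofReal (2 ^ n) * (1 + ENNReal.ofReal (2 ^ n))

lemma doublingConst_ne_top : doublingConst n ≠ ∞ := by
  unfold doublingConst; finiteness

lemma doublingConst_ne_zero : doublingConst n ≠ 0 := by
  have : (0 : ℝ) < 2 ^ n := by positivity
  simp [doublingConst]

lemma setLIntegral_double_le {b : (Fin n → ℝ) → ℝ} (hb : LocallyIntegrable b) {N : ℝ≥0∞}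
    (hN : MeanOscLE b N) (z : Fin n → ℝ) {R : ℝ} (hR : 0 < R) :
    ∫⁻ y in closedBall z (2 * R), ‖b y - ⨍ w in closedBall z R, b w‖ₑ ≤
      doublingConst n * N * ballVol n R := by
  set a := ⨍ w in closedBall z R, b w
  set a2 := ⨍ w in closedBall z (2 * R), b w
  have hR2 : 0 < 2 * R := by positivity
  have h2 := hN z (2 * R) hR2
  have hsub : closedBall z R ⊆ closedBall z (2 * R) := closedBall_subset_closedBall (by linarith)
  have h1 : ‖a - a2‖ₑ ≤ ENNReal.ofReal (2 ^ n) * N := by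
    calc ‖a - a2‖ₑ ≤ (ballVol n R)⁻¹ * ∫⁻ y in closedBall z R, ‖b y - a2‖ₑ :=
          enorm_average_sub_le hR (hb.integrableOn_isCompact (isCompact_closedBall _ _)) _
      _ ≤ (ballVol n R)⁻¹ * (N * ballVol n (2 * R)) := by
          gcongr
          exact (lintegral_mono_set hsub).trans h2
      _ = ((ballVol n R)⁻¹ * ballVol n R) * (ENNReal.ofReal (2 ^ n) * N) := by
          rw [ballVol_mul zero_le_two]; ring
      _ = _ := by rw [ballVol_inv_mul_cancel hR, one_mul]
  calc ∫⁻ y in closedBall z (2 * R), ‖b y - a‖ₑ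
      ≤ ∫⁻ y in closedBall z (2 * R), (‖b y - a2‖ₑ + ‖a - a2‖ₑ) := by
        refine lintegral_mono fun y => ?_
        rw [enorm_sub_rev a a2]
        calc ‖b y - a‖ₑ = ‖(b y - a2) + (a2 - a)‖ₑ := by rw [sub_add_sub_cancel]
          _ ≤ _ := enorm_add_le _ _
    _ = (∫⁻ y in closedBall z (2 * R), ‖b y - a2‖ₑ) + ‖a - a2‖ₑ * ballVol n (2 * R) := by
        rw [lintegral_add_right _ measurable_const, setLIntegral_const,
          volume_closedBall_eq_ballVol z hR2.le]
    _ ≤ N * ballVol n (2 * R) + (ENNReal.ofReal (2 ^ n) * N) * ballVol n (2 * R) := by gcongr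
    _ = _ := by rw [ballVol_mul zero_le_two, doublingConst]; ring

lemma exists_stopping_radius {f : (Fin n → ℝ) → ℝ≥0∞} {K : ℝ≥0∞} {R δ : ℝ} {x : Fin n → ℝ}
    (hδ0 : 0 < δ) (hδR : δ ≤ R) (hδ : K * ballVol n δ < ∫⁻ y in closedBall x δ, f y)
    (hlarge : ∀ r, R / 10 ≤ r → r ≤ R → ∫⁻ y in closedBall x r, f y ≤ K * ballVol n r) :
    ∃ r, 0 < r ∧ 5 * r ≤ R ∧ K * ballVol n r < ∫⁻ y in closedBall x r, f y ∧
      ∫⁻ y in closedBall x (5 * r), f y ≤ K * ballVol n (5 * r) := by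
  set S : Set ℝ := {r | 0 < r ∧ r ≤ R ∧ K * ballVol n r < ∫⁻ y in closedBall x r, f y}
  have hS : δ ∈ S := ⟨hδ0, hδR, hδ⟩
  have hbdd : BddAbove S := ⟨R, fun r hr => hr.2.1⟩
  have hpos : 0 < sSup S := hδ0.trans_le (le_csSup hbdd hS)
  obtain ⟨r, ⟨hr0, hrR, hr⟩, hlt⟩ := exists_lt_of_lt_csSup ⟨δ, hS⟩ (half_lt_self hpos)
  have hr10 : r < R / 10 := by
    by_contra! h
    exact absurd hr (not_lt.2 (hlarge r h hrR))
  refine ⟨r, hr0, by linarith, hr, ?_⟩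
  by_contra! h
  have := le_csSup hbdd (show 5 * r ∈ S from ⟨by positivity, by linarith, h⟩)
  linarith

lemma ae_exists_small_radius {f : (Fin n → ℝ) → ℝ≥0∞} (hf : Measurable f) {T : Set (Fin n → ℝ)}
    (hT : IsOpen T) (hfT : ∫⁻ y in T, f y ≠ ∞) (K : ℝ≥0∞) {R : ℝ} (hR : 0 < R) :
    ∀ᵐ x, x ∈ T → K < f x →
      ∃ δ, 0 < δ ∧ δ ≤ R ∧ K * ballVol n δ < ∫⁻ y in closedBall x δ, f y := by
  have h := (Besicovitch.vitaliFamily (volume : Measure (Fin n → ℝ))).ae_tendsto_lintegral_div'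
    (f := T.indicator f) (hf.indicator hT.measurableSet)
    (by rwa [lintegral_indicator hT.measurableSet])
  filter_upwards [h] with x hx hxT hKx
  have h1 := hx.comp (Besicovitch.tendsto_filterAt volume x)
  rw [indicator_of_mem hxT] at h1
  have h2 := h1.eventually (lt_mem_nhds hKx)
  obtain ⟨δ, hδ, hδ0, hδR⟩ := (h2.and (Ioc_mem_nhdsGT hR)).exists
  refine ⟨δ, hδ0, hδR, ?_⟩
  simp only [Function.comp] at hδ
  rw [volume_closedBall_eq_ballVol _ hδ0.le] at hδ
  refine (ENNReal.lt_div_iff_mul_lt (Or.inl (ballVol_ne_zero hδ0))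
    (Or.inl ballVol_ne_top)).1 hδ |>.trans_le ?_
  gcongr
  exact indicator_le_self _ _ _

lemma oscDistribution_add_le {b : (Fin n → ℝ) → ℝ} (hbm : Measurable b)
    (hb : LocallyIntegrable b) {N : ℝ≥0∞} (hN : MeanOscLE b N) (hN0 : N ≠ 0) (hNt : N ≠ ∞)
    (l : ℝ≥0∞) :
    oscDistribution b (l + 2 * ENNReal.ofReal (10 ^ n) * doublingConst n * N) ≤
      2⁻¹ * oscDistribution b l := by
  set K := 2 * ENNReal.ofReal (10 ^ n) * doublingConst n * N with hK
  have h10 : ENNReal.ofReal (10 ^ n) ≠ 0 := by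
    have : (0 : ℝ) < 10 ^ n := by positivity
    simp
  have hKt : K ≠ ∞ := by
    have := doublingConst_ne_top (n := n)
    finiteness
  refine iSup_le fun z => iSup_le fun R => iSup_le fun hR => ?_
  set a := ⨍ w in closedBall z R, b w
  set f : (Fin n → ℝ) → ℝ≥0∞ := fun y => ‖b y - a‖ₑ with hf
  have hfm : Measurable f := (hbm.sub_const a).enorm
  have hdouble := setLIntegral_double_le hb hN z hR
  have hfin : ∫⁻ y in closedBall z (2 * R), f y ≠ ∞ := by
    refine ne_top_of_le_ne_top ?_ hdouble
    have := doublingConst_ne_top (n := n)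
    have := ballVol_ne_top (n := n) (R := R)
    finiteness
  set E : Set (Fin n → ℝ) := closedBall z R ∩ {x | l + K < f x} with hE
  have hae := ae_exists_small_radius hfm (isOpen_ball (x := z) (ε := 2 * R))
    (ne_top_of_le_ne_top hfin (lintegral_mono_set ball_subset_closedBall)) K hR
  set E' : Set (Fin n → ℝ) := E ∩ {x | ∃ r, 0 < r ∧ 5 * r ≤ R ∧
    K * ballVol n r < ∫⁻ y in closedBall x r, f y ∧
      ∫⁻ y in closedBall x (5 * r), f y ≤ K * ballVol n (5 * r)} with hE'
  have hEE' : volume E ≤ volume E' := by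
    refine measure_mono_ae ?_
    filter_upwards [hae] with x hx hxE
    obtain ⟨hxz, hxl⟩ := hxE
    obtain ⟨δ, hδ0, hδR, hδ⟩ := hx (closedBall_subset_ball (by linarith) hxz)
      (lt_of_le_of_lt le_add_self hxl)
    refine ⟨⟨hxz, hxl⟩, exists_stopping_radius hδ0 hδR hδ fun r hr1 hr2 => ?_⟩
    calc ∫⁻ y in closedBall x r, f y ≤ ∫⁻ y in closedBall z (2 * R), f y := by
          refine lintegral_mono_set (closedBall_subset_closedBall' ?_)
          have := mem_closedBall.1 hxz
          linarith
      _ ≤ doublingConst n * N * ballVol n (10 * (R / 10)) := by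
          rwa [mul_div_cancel₀ R (by norm_num)]
      _ = ENNReal.ofReal (10 ^ n) * doublingConst n * N * ballVol n (R / 10) := by
          rw [ballVol_mul (by norm_num)]; ring
      _ ≤ K * ballVol n r := by
          rw [hK]
          gcongr
          · exact le_mul_of_one_le_left zero_le one_le_two
          · exact ballVol_mono (by positivity) hr1
  choose! r hr using fun x (hx : x ∈ E') => hx.2
  obtain ⟨u, huE, hu, hcov, hsum⟩ := exists_countable_enlargement_cover (s := E')
    (T := closedBall z (2 * R)) (S := R) (f := f) (K := K) (fun x hx => (hr x hx).1)
    (fun x hx => by linarith [(hr x hx).1, (hr x hx).2.1]) (fun x hx => (hr x hx).2.2.1.le)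
    (fun x hx => closedBall_subset_closedBall' (by
      have := mem_closedBall.1 hx.1.1
      linarith [(hr x hx).1, (hr x hx).2.1]))
  have hpiece : ∀ x ∈ u, volume (E' ∩ closedBall x (5 * r x)) ≤
      oscDistribution b l * ballVol n (5 * r x) := by
    intro x hx
    have h0 : 0 < 5 * r x := by linarith [(hr x (huE hx)).1]
    refine (measure_mono ?_).trans (volume_osc_le b l x h0)
    rintro y ⟨⟨⟨-, hy⟩, -⟩, hyx⟩
    refine ⟨hyx, ?_⟩
    set a' := ⨍ w in closedBall x (5 * r x), b w
    have h1 : ‖a' - a‖ₑ ≤ K := by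
      refine (enorm_average_sub_le h0
        (hb.integrableOn_isCompact (isCompact_closedBall _ _)) a).trans ?_
      calc (ballVol n (5 * r x))⁻¹ * ∫⁻ y in closedBall x (5 * r x), ‖b y - a‖ₑ
          ≤ (ballVol n (5 * r x))⁻¹ * (K * ballVol n (5 * r x)) := by
            gcongr; exact (hr x (huE hx)).2.2.2
        _ = K := by rw [mul_left_comm, ballVol_inv_mul_cancel h0, mul_one]
    have h2 : ‖b y - a‖ₑ ≤ ‖b y - a'‖ₑ + K := by
      calc ‖b y - a‖ₑ = ‖(b y - a') + (a' - a)‖ₑ := by rw [sub_add_sub_cancel]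
        _ ≤ ‖b y - a'‖ₑ + ‖a' - a‖ₑ := enorm_add_le _ _
        _ ≤ _ := by gcongr
    exact (ENNReal.add_lt_add_iff_right hKt).1 (lt_of_lt_of_le hy h2)
  have hK0 : K ≠ 0 := by
    have := doublingConst_ne_zero (n := n)
    simp only [hK, ne_eq, mul_eq_zero, not_or]
    exact ⟨⟨⟨two_ne_zero, h10⟩, this⟩, hN0⟩
  have hE'sum : volume E' ≤ oscDistribution b l * ∑' x : u, ballVol n (5 * r x) := by
    calc volume E' ≤ volume (⋃ x ∈ u, E' ∩ closedBall x (5 * r x)) := by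
          refine measure_mono fun x hx => ?_
          obtain ⟨y, hy, hxy⟩ := mem_iUnion₂.1 (hcov hx)
          exact mem_iUnion₂.2 ⟨y, hy, hx, hxy⟩
      _ ≤ ∑' x : u, volume (E' ∩ closedBall (x : Fin n → ℝ) (5 * r x)) := measure_biUnion_le _ hu _
      _ ≤ ∑' x : u, oscDistribution b l * ballVol n (5 * r x) := by
          gcongr with x
          exact hpiece x x.2
      _ = _ := ENNReal.tsum_mul_left
  have hsum' : ∑' x : u, ballVol n (5 * r x) ≤ 2⁻¹ * ballVol n R := by
    rw [← ENNReal.mul_le_mul_iff_right hK0 hKt]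
    calc K * ∑' x : u, ballVol n (5 * r x)
        ≤ ENNReal.ofReal (5 ^ n) * (doublingConst n * N * ballVol n R) :=
          hsum.trans (by gcongr)
      _ ≤ ENNReal.ofReal (10 ^ n) * (doublingConst n * N * ballVol n R) := by
          gcongr
          norm_num
      _ = (2⁻¹ * 2) * (ENNReal.ofReal (10 ^ n) * (doublingConst n * N * ballVol n R)) := by
          rw [ENNReal.inv_mul_cancel two_ne_zero ofNat_ne_top, one_mul]
      _ = K * (2⁻¹ * ballVol n R) := by rw [hK]; ring
  calc (ballVol n R)⁻¹ * volume E
      ≤ (ballVol n R)⁻¹ * (oscDistribution b l * (2⁻¹ * ballVol n R)) := by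
        gcongr
        exact hEE'.trans (hE'sum.trans (by gcongr))
    _ = ((ballVol n R)⁻¹ * ballVol n R) * (2⁻¹ * oscDistribution b l) := by ring
    _ = _ := by rw [ballVol_inv_mul_cancel hR, one_mul]

lemma oscDistribution_nat_mul_le {b : (Fin n → ℝ) → ℝ} (hbm : Measurable b)
    (hb : LocallyIntegrable b) {N : ℝ≥0∞} (hN : MeanOscLE b N) (hN0 : N ≠ 0) (hNt : N ≠ ∞)
    (j : ℕ) :
    oscDistribution b (j * (2 * ENNReal.ofReal (10 ^ n) * doublingConst n * N)) ≤ 2⁻¹ ^ j := by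
  induction j with
  | zero => simpa using oscDistribution_le_one b _
  | succ j ih =>
    rw [Nat.cast_succ, add_mul, one_mul, pow_succ']
    exact (oscDistribution_add_le hbm hb hN hN0 hNt _).trans (by gcongr)

lemma pow_le_tsum_indicator {K e : ℝ≥0∞} (hK0 : K ≠ 0) (hKt : K ≠ ∞) (he : e ≠ ∞) {m : ℕ}
    (hm : m ≠ 0) : e ^ m ≤ ∑' j : ℕ, {e | j * K < e}.indicator (fun _ => ((j + 1) * K) ^ m) e := by
  by_cases h0 : e = 0
  · simp [h0, hm]
  have hex : ∃ k : ℕ, e ≤ k * K := by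
    obtain ⟨k, hk⟩ := ENNReal.exists_nat_gt (ENNReal.div_lt_top he hK0).ne
    exact ⟨k, ((ENNReal.div_le_iff hK0 hKt).1 hk.le)⟩
  classical
  obtain ⟨j, hj⟩ : ∃ j, Nat.find hex = j + 1 := by
    refine Nat.exists_eq_succ_of_ne_zero fun h => h0 ?_
    simpa [h] using Nat.find_spec hex
  have h1 : e ≤ (j + 1) * K := by
    have := Nat.find_spec hex
    rw [hj] at this
    exact_mod_cast this
  have h2 : j * K < e := not_le.1 (Nat.find_min hex (by omega))
  refine le_trans ?_ (ENNReal.le_tsum j)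
  rw [indicator_of_mem (by exact h2)]
  gcongr

/-- The **John–Nirenberg inequality** in its `L^m` form. -/
lemma exists_ballAvg_osc_le (n : ℕ) {m : ℕ} (hm : m ≠ 0) : ∃ C : ℝ≥0∞, C ≠ ∞ ∧
    ∀ b : (Fin n → ℝ) → ℝ, Measurable b → LocallyIntegrable b → ∀ N : ℝ≥0∞, MeanOscLE b N →
      N ≠ ∞ → ∀ z R, 0 < R →
        ballAvg m R (fun y => ‖b y - ⨍ w in closedBall z R, b w‖ₑ) z ≤ C * N := by
  set c : ℝ≥0∞ := ∑' j : ℕ, ((j : ℝ≥0∞) + 1) ^ m * 2⁻¹ ^ j with hc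
  have hct : c ≠ ∞ := by
    have h1 := ((summable_nat_add_iff 1).2 (summable_pow_mul_geometric_of_norm_lt_one m
      (r := (2⁻¹ : ℝ)) (by norm_num))).mul_left 2
    convert h1.tsum_ofReal_ne_top using 3 with j
    have h2 : (2⁻¹ : ℝ≥0∞) = ENNReal.ofReal 2⁻¹ := by
      rw [ENNReal.ofReal_inv_of_pos two_pos, ENNReal.ofReal_ofNat]
    have h3 : (j : ℝ≥0∞) + 1 = ENNReal.ofReal (j + 1) := by
      rw [ENNReal.ofReal_add (by positivity) one_pos.le]; simp
    rw [h2, h3, ← ENNReal.ofReal_pow (by positivity), ← ENNReal.ofReal_pow (by positivity),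
      ← ENNReal.ofReal_mul (by positivity)]
    congr 1
    push_cast
    ring
  have hm0 : (0 : ℝ) < m := by positivity
  refine ⟨c ^ (1 / (m : ℝ)) * (2 * ENNReal.ofReal (10 ^ n) * doublingConst n), ?_, ?_⟩
  · have := doublingConst_ne_top (n := n)
    finiteness
  intro b hbm hb N hN hNt z R hR
  set a := ⨍ w in closedBall z R, b w
  have hfm : Measurable fun y => ‖b y - a‖ₑ := (hbm.sub_const a).enorm
  by_cases hN0 : N = 0
  · have h := hN z R hR
    rw [hN0, zero_mul, nonpos_iff_eq_zero, lintegral_eq_zero_iff hfm] at h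
    have h' : ∫⁻ y in closedBall z R, ‖b y - a‖ₑ ^ (m : ℝ) = 0 := by
      rw [lintegral_eq_zero_iff (hfm.pow_const _)]
      filter_upwards [h] with y hy
      simp only [Pi.zero_apply] at hy ⊢
      rw [hy, ENNReal.zero_rpow_of_pos hm0]
    rw [ballAvg, h', mul_zero, ENNReal.zero_rpow_of_pos (by positivity)]
    exact zero_le
  set K := 2 * ENNReal.ofReal (10 ^ n) * doublingConst n * N with hK
  have hKt : K ≠ ∞ := by
    have := doublingConst_ne_top (n := n)
    finiteness
  have hK0 : K ≠ 0 := by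
    have := doublingConst_ne_zero (n := n)
    have h10 : (0 : ℝ) < 10 ^ n := by positivity
    simp [hK, this, hN0]
  have hmain : ∫⁻ y in closedBall z R, ‖b y - a‖ₑ ^ (m : ℝ) ≤ K ^ m * c * ballVol n R := by
    calc ∫⁻ y in closedBall z R, ‖b y - a‖ₑ ^ (m : ℝ)
        ≤ ∫⁻ y in closedBall z R, ∑' j : ℕ,
            {y | j * K < ‖b y - a‖ₑ}.indicator (fun _ => ((j + 1) * K) ^ m) y := by
          refine lintegral_mono fun y => ?_
          rw [ENNReal.rpow_natCast]
          exact pow_le_tsum_indicator hK0 hKt enorm_ne_top hm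
      _ = ∑' j : ℕ, ((j + 1) * K) ^ m * volume (closedBall z R ∩ {y | j * K < ‖b y - a‖ₑ}) := by
          rw [lintegral_tsum]
          · refine tsum_congr fun j => ?_
            rw [lintegral_indicator_const (measurableSet_lt measurable_const hfm),
              Measure.restrict_apply (measurableSet_lt measurable_const hfm), inter_comm]
          · exact fun j => (measurable_const.indicator
              (measurableSet_lt measurable_const hfm)).aemeasurable
      _ ≤ ∑' j : ℕ, ((j + 1) * K) ^ m * (2⁻¹ ^ j * ballVol n R) := by
          gcongr with j
          exact (volume_osc_le b _ z hR).trans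
            (by gcongr; exact oscDistribution_nat_mul_le hbm hb hN hN0 hNt j)
      _ = _ := by
          rw [hc, ← ENNReal.tsum_mul_left, ← ENNReal.tsum_mul_right]
          refine tsum_congr fun j => ?_
          rw [mul_pow]
          ring
  calc ballAvg m R (fun y => ‖b y - a‖ₑ) z
      ≤ ((ballVol n R)⁻¹ * (K ^ m * c * ballVol n R)) ^ (1 / (m : ℝ)) := by
        unfold ballAvg
        gcongr
    _ = (c * K ^ (m : ℝ)) ^ (1 / (m : ℝ)) := by
        rw [mul_left_comm, ballVol_inv_mul_cancel hR, mul_one, mul_comm, ENNReal.rpow_natCast]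
    _ = c ^ (1 / (m : ℝ)) * K := by
        rw [ENNReal.mul_rpow_of_nonneg _ _ (by positivity), ← ENNReal.rpow_mul,
          mul_one_div_cancel hm0.ne', ENNReal.rpow_one]
    _ = _ := by rw [hK]; ring

end JohnNirenberg

section ScaleForm

open Set Filter Topology

variable {n : ℕ}

/-- The `L^q` norm of an `ℝ≥0∞`-valued function. -/
def lqNorm (q : ℝ) (f : (Fin n → ℝ) → ℝ≥0∞) : ℝ≥0∞ := (∫⁻ x, f x ^ q) ^ (1 / q)

lemma lqNorm_rpow {q : ℝ} (hq : 0 < q) (f : (Fin n → ℝ) → ℝ≥0∞) :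
    lqNorm q f ^ q = ∫⁻ x, f x ^ q := by
  rw [lqNorm, ← ENNReal.rpow_mul, one_div_mul_cancel hq.ne', ENNReal.rpow_one]

lemma lintegral_mul_le_lqNorm {q q' : ℝ} (hq : q.HolderConjugate q')
    {f g : (Fin n → ℝ) → ℝ≥0∞} (hf : Measurable f) (hg : Measurable g) :
    ∫⁻ x, f x * g x ≤ lqNorm q f * lqNorm q' g :=
  ENNReal.lintegral_mul_le_Lp_mul_Lq _ hq hf.aemeasurable hg.aemeasurable

lemma setLIntegral_Ioc_rpow {a ρ : ℝ} (ha : 0 < a) (hρ : 0 ≤ ρ) :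
    ∫⁻ R in Ioc 0 ρ, ENNReal.ofReal (R ^ (a - 1)) = ENNReal.ofReal (ρ ^ a / a) := by
  have h1 := intervalIntegral.intervalIntegrable_rpow' (a := 0) (b := ρ) (r := a - 1) (by linarith)
  rw [intervalIntegrable_iff_integrableOn_Ioc_of_le hρ] at h1
  rw [← ofReal_integral_eq_lintegral_ofReal h1, ← intervalIntegral.integral_of_le hρ,
    integral_rpow (Or.inl (by linarith)), sub_add_cancel, Real.zero_rpow ha.ne', sub_zero]
  exact (ae_restrict_iff' measurableSet_Ioc).2
    (Eventually.of_forall fun R hR => Real.rpow_nonneg hR.1.le _)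

lemma setLIntegral_Ioi_rpow {a ρ : ℝ} (ha : 0 < a) (hρ : 0 < ρ) :
    ∫⁻ R in Ioi ρ, ENNReal.ofReal (R ^ (-a - 1)) = ENNReal.ofReal (ρ ^ (-a) / a) := by
  have h1 := integrableOn_Ioi_rpow_of_lt (a := -a - 1) (by linarith) hρ
  rw [← ofReal_integral_eq_lintegral_ofReal h1, integral_Ioi_rpow_of_lt (by linarith) hρ,
    sub_add_cancel, neg_div_neg_eq]
  exact (ae_restrict_iff' measurableSet_Ioi).2
    (Eventually.of_forall fun R hR => Real.rpow_nonneg (hρ.le.trans (le_of_lt hR)) _)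

/-- Hedberg's interpolation argument. -/
lemma lintegral_rpow_mul_le_interpolation {α β : ℝ} (hα : 0 < α) (hαβ : α < β) {ψ : ℝ → ℝ≥0∞}
    {A G : ℝ≥0∞} (h1 : ∀ R, 0 < R → ψ R ≤ A)
    (h2 : ∀ R, 0 < R → ψ R ≤ ENNReal.ofReal (R ^ (-β)) * G) :
    ∫⁻ R in Ioi 0, ENNReal.ofReal (R ^ (α - 1)) * ψ R ≤
      ENNReal.ofReal (1 / α + 1 / (β - α)) * (A ^ (1 - α / β) * G ^ (α / β)) := by
  have hβ : 0 < β := hα.trans hαβ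
  have hθ : 0 < α / β := by positivity
  have hθ1 : 0 < 1 - α / β := by rw [sub_pos, div_lt_one hβ]; exact hαβ
  have hc : ENNReal.ofReal (1 / α + 1 / (β - α)) ≠ 0 := by
    have : 0 < β - α := by linarith
    rw [Ne, ENNReal.ofReal_eq_zero, not_le]; positivity
  have hzero : (∀ R, 0 < R → ψ R = 0) → ∫⁻ R in Ioi 0, ENNReal.ofReal (R ^ (α - 1)) * ψ R = 0 := by
    intro h
    rw [setLIntegral_congr_fun (g := fun _ => 0) measurableSet_Ioi, lintegral_zero]
    intro R hR
    simp [h R hR]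
  by_cases hA0 : A = 0
  · rw [hzero fun R hR => by simpa [hA0] using h1 R hR]; exact zero_le
  by_cases hG0 : G = 0
  · rw [hzero fun R hR => by simpa [hG0] using h2 R hR]; exact zero_le
  by_cases hAt : A = ∞
  · rw [hAt, ENNReal.top_rpow_of_pos hθ1, ENNReal.top_mul (by simp [hG0, hθ.not_gt]),
      ENNReal.mul_top hc]
    exact le_top
  by_cases hGt : G = ∞
  · rw [hGt, ENNReal.top_rpow_of_pos hθ, ENNReal.mul_top (by simp [hA0, hθ1.not_gt]),
      ENNReal.mul_top hc]
    exact le_top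
  obtain ⟨a, ha0, rfl⟩ : ∃ a : ℝ, 0 < a ∧ A = ENNReal.ofReal a :=
    ⟨A.toReal, ENNReal.toReal_pos hA0 hAt, (ENNReal.ofReal_toReal hAt).symm⟩
  obtain ⟨g, hg0, rfl⟩ : ∃ g : ℝ, 0 < g ∧ G = ENNReal.ofReal g :=
    ⟨G.toReal, ENNReal.toReal_pos hG0 hGt, (ENNReal.ofReal_toReal hGt).symm⟩
  set ρ := (g / a) ^ (1 / β) with hρ
  have hρ0 : 0 < ρ := by positivity
  have hρα : ∀ x : ℝ, ρ ^ x = g ^ (x / β) * a ^ (-(x / β)) := by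
    intro x
    rw [hρ, ← Real.rpow_mul (by positivity), Real.div_rpow hg0.le ha0.le, Real.rpow_neg ha0.le,
      one_div_mul_eq_div, div_eq_mul_inv (g ^ _)]
  have e1 : a * ρ ^ α = a ^ (1 - α / β) * g ^ (α / β) := by
    rw [hρα, sub_eq_add_neg, Real.rpow_add ha0, Real.rpow_one]; ring
  have e2 : g * ρ ^ (-(β - α)) = a ^ (1 - α / β) * g ^ (α / β) := by
    have h3 : -(β - α) / β = -1 + α / β := by field_simp; ring
    rw [hρα, h3, Real.rpow_add hg0, Real.rpow_neg_one, neg_add, neg_neg, ← sub_eq_add_neg]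
    field_simp
  rw [← Ioc_union_Ioi_eq_Ioi hρ0.le]
  calc ∫⁻ R in Ioc 0 ρ ∪ Ioi ρ, ENNReal.ofReal (R ^ (α - 1)) * ψ R
      ≤ (∫⁻ R in Ioc 0 ρ, ENNReal.ofReal (R ^ (α - 1)) * ψ R) +
          ∫⁻ R in Ioi ρ, ENNReal.ofReal (R ^ (α - 1)) * ψ R := lintegral_union_le _ _ _
    _ ≤ (∫⁻ R in Ioc 0 ρ, ENNReal.ofReal (R ^ (α - 1)) * ENNReal.ofReal a) +
          ∫⁻ R in Ioi ρ, ENNReal.ofReal (R ^ (-(β - α) - 1)) * ENNReal.ofReal g := by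
        gcongr ?_ + ?_
        · refine setLIntegral_mono' measurableSet_Ioc fun R hR => ?_
          gcongr
          exact h1 R hR.1
        · refine setLIntegral_mono' measurableSet_Ioi fun R hR => ?_
          have hR0 : 0 < R := hρ0.trans hR
          have : -(β - α) - 1 = (α - 1) + -β := by ring
          rw [this, Real.rpow_add hR0, ENNReal.ofReal_mul (by positivity), mul_assoc]
          gcongr
          exact h2 R hR0
    _ = ENNReal.ofReal (1 / α + 1 / (β - α)) *
          ENNReal.ofReal (a ^ (1 - α / β) * g ^ (α / β)) := by
        have hβα : 0 < β - α := by linarith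
        rw [lintegral_mul_const _ (by fun_prop), lintegral_mul_const _ (by fun_prop),
          setLIntegral_Ioc_rpow hα hρ0.le, setLIntegral_Ioi_rpow hβα hρ0,
          ← ENNReal.ofReal_mul (by positivity), ← ENNReal.ofReal_mul (by positivity),
          ← ENNReal.ofReal_mul (by positivity), ← ENNReal.ofReal_add (by positivity)
            (by positivity)]
        congr 1
        rw [add_mul]
        congr 1
        · rw [← e1]; ring
        · rw [← e2]; ring
    _ = _ := by
        rw [ENNReal.ofReal_mul (by positivity), ENNReal.ofReal_rpow_of_pos ha0,
          ENNReal.ofReal_rpow_of_pos hg0]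

lemma exists_lqNorm_maximalFn_le (hn : n ≠ 0) {u q : ℝ} (hu : 0 < u) (huq : u < q) :
    ∃ C : ℝ≥0∞, C ≠ ∞ ∧ ∀ f : (Fin n → ℝ) → ℝ≥0∞, Measurable f →
      lqNorm q (fun z => maximalFn (fun y => f y ^ u) z ^ (1 / u)) ≤ C * lqNorm q f := by
  have hq : 0 < q := hu.trans huq
  obtain ⟨C, hC, h⟩ := lintegral_maximalFn_rpow_le hn (p := q / u) (by rwa [one_lt_div hu])
  refine ⟨C ^ (1 / q), by finiteness, fun f hf => ?_⟩
  rw [lqNorm, lqNorm, ← ENNReal.mul_rpow_of_nonneg _ _ (by positivity)]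
  gcongr
  convert h (fun y => f y ^ u) (hf.pow_const u) using 3 with x x
  · rw [← ENNReal.rpow_mul]; congr 1; field_simp
  · ext x
    rw [← ENNReal.rpow_mul]; congr 1; field_simp

lemma ballAvg_le_rpow_mul_lqNorm {u q R : ℝ} (hu : 0 < u) (huq : u ≤ q) (hR : 0 < R)
    {f : (Fin n → ℝ) → ℝ≥0∞} (hf : Measurable f) (z : Fin n → ℝ) :
    ballAvg u (2 * R) f z ≤ ENNReal.ofReal (R ^ (-(n / q : ℝ))) * lqNorm q f := by
  have hq : 0 < q := hu.trans_le huq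
  refine (ballAvg_mono_exponent hu huq (by linarith) hf z).trans ?_
  rw [ballAvg, lqNorm, ENNReal.mul_rpow_of_nonneg _ _ (by positivity)]
  gcongr
  · rw [ballVol, ← ENNReal.ofReal_inv_of_pos (by positivity),
      ENNReal.ofReal_rpow_of_pos (by positivity)]
    refine ENNReal.ofReal_le_ofReal ?_
    have e : R ^ (-(n / q : ℝ)) = ((R ^ n)⁻¹) ^ (1 / q) := by
      rw [← Real.rpow_natCast, ← Real.rpow_neg hR.le, ← Real.rpow_mul hR.le]
      congr 1; ring
    rw [e]
    gcongr
    linarith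
  · exact Measure.restrict_le_self

lemma exists_scale_form_le (hn : n ≠ 0) {α q s s' u : ℝ} (hα : 0 < α)
    (hqs : α / n = 1 / q - 1 / s) (hs : s.HolderConjugate s') (hu : 0 < u) (huq : u < q)
    (hus : u < s') : ∃ C : ℝ≥0∞, C ≠ ∞ ∧ ∀ g H : (Fin n → ℝ) → ℝ≥0∞, Measurable g → Measurable H →
      ∫⁻ R in Ioi (0 : ℝ), ENNReal.ofReal (R ^ (α - 1)) *
        ∫⁻ z, ballAvg u (2 * R) g z * ballAvg u (2 * R) H z ≤ C * lqNorm q g * lqNorm s' H := by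
  have hq : 0 < q := hu.trans huq
  have hs0 := hs.pos
  have hn0 : (0 : ℝ) < n := by positivity
  obtain ⟨C₁, hC₁, hM₁⟩ := exists_lqNorm_maximalFn_le hn hu huq
  obtain ⟨C₂, hC₂, hM₂⟩ := exists_lqNorm_maximalFn_le hn hu hus
  set c₀ := ENNReal.ofReal (2 ^ n) ^ (1 / u)
  set K := ENNReal.ofReal (1 / α + 1 / (n / q - α))
  have hα' : α = n * (1 / q - 1 / s) := by rw [← hqs]; field_simp
  have hαβ : α < n / q := by
    have : 0 < (n : ℝ) * (1 / s) := by positivity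
    rw [hα', mul_sub, mul_one_div]; linarith
  have hθ : α / (n / q) = 1 - q / s := by rw [hα']; field_simp
  have hθ1 : 1 - α / (n / q) = q / s := by rw [hθ]; ring
  have hθ0 : 0 < 1 - q / s := by rw [← hθ]; positivity
  refine ⟨K * c₀ ^ (q / s) * c₀ * C₁ ^ (q / s) * C₂, by finiteness, fun g H hg hH => ?_⟩
  set Mg : (Fin n → ℝ) → ℝ≥0∞ := fun z => maximalFn (fun y => g y ^ u) z ^ (1 / u)
  set MH : (Fin n → ℝ) → ℝ≥0∞ := fun z => maximalFn (fun y => H y ^ u) z ^ (1 / u)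
  have hMg : Measurable Mg := (measurable_maximalFn (hg.pow_const u)).pow_const _
  have hMH : Measurable MH := (measurable_maximalFn (hH.pow_const u)).pow_const _
  have hmeas : ∀ f : (Fin n → ℝ) → ℝ≥0∞, Measurable f →
      Measurable fun x : ℝ × (Fin n → ℝ) => ballAvg u (2 * x.1) f x.2 := fun f hf =>
    measurable_ballAvg u hf measurable_snd (measurable_fst.const_mul 2)
  calc ∫⁻ R in Ioi (0 : ℝ), ENNReal.ofReal (R ^ (α - 1)) *
        ∫⁻ z, ballAvg u (2 * R) g z * ballAvg u (2 * R) H z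
      = ∫⁻ R in Ioi (0 : ℝ), ∫⁻ z, ENNReal.ofReal (R ^ (α - 1)) *
          (ballAvg u (2 * R) g z * ballAvg u (2 * R) H z) := by
        refine lintegral_congr fun R => ?_
        rw [lintegral_const_mul']
        exact ENNReal.ofReal_ne_top
    _ = ∫⁻ z, ∫⁻ R in Ioi (0 : ℝ), ENNReal.ofReal (R ^ (α - 1)) *
          (ballAvg u (2 * R) g z * ballAvg u (2 * R) H z) := by
        refine lintegral_lintegral_swap (Measurable.aemeasurable ?_)
        exact (Measurable.ennreal_ofReal (by fun_prop)).mul ((hmeas g hg).mul (hmeas H hH))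
    _ ≤ ∫⁻ z, K * c₀ ^ (q / s) * c₀ * lqNorm q g ^ (1 - q / s) * (Mg z ^ (q / s) * MH z) := by
        refine lintegral_mono fun z => ?_
        calc ∫⁻ R in Ioi (0 : ℝ), ENNReal.ofReal (R ^ (α - 1)) *
              (ballAvg u (2 * R) g z * ballAvg u (2 * R) H z)
            ≤ ∫⁻ R in Ioi (0 : ℝ), (ENNReal.ofReal (R ^ (α - 1)) * ballAvg u (2 * R) g z) *
                (c₀ * MH z) := by
              refine setLIntegral_mono' measurableSet_Ioi fun R hR => ?_
              rw [← mul_assoc]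
              gcongr
              exact ballAvg_le_maximalFn hu (mul_pos two_pos hR) H z
          _ = (∫⁻ R in Ioi (0 : ℝ), ENNReal.ofReal (R ^ (α - 1)) * ballAvg u (2 * R) g z) *
                (c₀ * MH z) := by
              rw [lintegral_mul_const]
              exact (Measurable.ennreal_ofReal (by fun_prop)).mul
                (measurable_ballAvg u hg measurable_const (measurable_id.const_mul 2))
          _ ≤ (K * ((c₀ * Mg z) ^ (q / s) * lqNorm q g ^ (1 - q / s))) * (c₀ * MH z) := by
              rw [← hθ, ← hθ1]
              gcongr
              exact lintegral_rpow_mul_le_interpolation hα hαβ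
                (fun R hR => ballAvg_le_maximalFn hu (mul_pos two_pos hR) g z)
                (fun R hR => ballAvg_le_rpow_mul_lqNorm hu huq.le hR hg z)
          _ = _ := by rw [ENNReal.mul_rpow_of_nonneg _ _ (by positivity)]; ring
    _ = K * c₀ ^ (q / s) * c₀ * lqNorm q g ^ (1 - q / s) * ∫⁻ z, Mg z ^ (q / s) * MH z := by
        rw [lintegral_const_mul _ (by fun_prop)]
    _ ≤ K * c₀ ^ (q / s) * c₀ * lqNorm q g ^ (1 - q / s) *
          (lqNorm s (fun z => Mg z ^ (q / s)) * lqNorm s' MH) := by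
        gcongr
        exact lintegral_mul_le_lqNorm hs (hMg.pow_const _) hMH
    _ ≤ K * c₀ ^ (q / s) * c₀ * lqNorm q g ^ (1 - q / s) *
          ((C₁ * lqNorm q g) ^ (q / s) * (C₂ * lqNorm s' H)) := by
        have : lqNorm s (fun z => Mg z ^ (q / s)) = lqNorm q Mg ^ (q / s) := by
          simp only [lqNorm, ← ENNReal.rpow_mul, div_mul_cancel₀ q hs0.ne']
          congr 1
          field_simp
        rw [this]
        gcongr
        · exact hM₁ g hg
        · exact hM₂ H hH
    _ = K * c₀ ^ (q / s) * c₀ * C₁ ^ (q / s) * C₂ *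
          (lqNorm q g ^ (1 - q / s) * lqNorm q g ^ (q / s)) * lqNorm s' H := by
        rw [ENNReal.mul_rpow_of_nonneg _ _ (by positivity)]; ring
    _ = _ := by
        rw [← ENNReal.rpow_add_of_nonneg _ _ hθ0.le (by positivity), sub_add_cancel,
          ENNReal.rpow_one]

end ScaleForm

section SliceEnlargement

open Set Filter Topology

variable {n : ℕ}

lemma exists_finset_cover_closedBall (n : ℕ) : ∃ T : Finset (Fin n → ℝ),
    (∀ j ∈ T, ‖j‖ ≤ 2) ∧ ∀ (w y : Fin n → ℝ) (τ : ℝ), 0 < τ → y ∈ closedBall w (2 * τ) →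
      ∃ j ∈ T, y ∈ closedBall (w + τ • j) (τ / 2) := by
  obtain ⟨t, hts, htf, hcov⟩ := (isCompact_closedBall (0 : Fin n → ℝ) 2).finite_cover_balls
    (e := 1 / 2) (by norm_num)
  refine ⟨htf.toFinset, fun j hj => by simpa using hts (htf.mem_toFinset.1 hj), ?_⟩
  intro w y τ hτ hy
  have h1 : τ⁻¹ • (y - w) ∈ closedBall (0 : Fin n → ℝ) 2 := by
    rw [mem_closedBall, dist_eq_norm] at hy
    rw [mem_closedBall_zero_iff, norm_smul, norm_inv, Real.norm_of_nonneg hτ.le,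
      inv_mul_le_iff₀ hτ]
    linarith
  obtain ⟨j, hj, hyj⟩ := mem_iUnion₂.1 (hcov h1)
  refine ⟨j, htf.mem_toFinset.2 hj, ?_⟩
  rw [mem_ball, dist_eq_norm] at hyj
  have h2 : y - (w + τ • j) = τ • (τ⁻¹ • (y - w) - j) := by
    rw [smul_sub, smul_inv_smul₀ hτ.ne']; abel
  rw [mem_closedBall, dist_eq_norm, h2, norm_smul, Real.norm_of_nonneg hτ.le]
  nlinarith

lemma exists_ballAvg_double_le (n : ℕ) {p q : ℝ} (hp : 0 < p) (hq : 0 < q) :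
    ∃ C : ℝ≥0∞, C ≠ ∞ ∧ ∀ τ, 0 < τ → ∀ f : (Fin n → ℝ) → ℝ≥0∞, Measurable f → ∀ w,
      ballAvg p (2 * τ) f w ≤
        C * ((ballVol n τ)⁻¹ * ∫⁻ y in closedBall w (3 * τ), ballAvg p τ f y ^ q) ^ (1 / q) := by
  obtain ⟨T, hT2, hT⟩ := exists_finset_cover_closedBall n
  refine ⟨((T.card : ℝ≥0∞) * ENNReal.ofReal (2 ^ n) ^ (p / q)) ^ (1 / p), ?_, ?_⟩
  · have : (T.card : ℝ≥0∞) ≠ ∞ := ENNReal.natCast_ne_top _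
    exact ENNReal.rpow_ne_top_of_nonneg (by positivity) (by finiteness)
  intro τ hτ f hf w
  set V := ballVol n τ
  have hV0 : V ≠ 0 := ballVol_ne_zero hτ
  have hVt : V ≠ ∞ := ballVol_ne_top
  set I := ∫⁻ y in closedBall w (3 * τ), ballAvg p τ f y ^ q
  have hg : Measurable fun y => ballAvg p τ f y ^ q :=
    (measurable_ballAvg p hf measurable_id measurable_const).pow_const q
  have hpiece : ∀ j ∈ T, ∫⁻ y in closedBall (w + τ • j) (τ / 2), f y ^ p ≤
      V * (ENNReal.ofReal (2 ^ n) * (V⁻¹ * I)) ^ (p / q) := by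
    intro j hj
    set X := ∫⁻ y in closedBall (w + τ • j) (τ / 2), f y ^ p
    have hW0 : ballVol n (τ / 2) ≠ 0 := ballVol_ne_zero (half_pos hτ)
    have hVW : V = ENNReal.ofReal (2 ^ n) * ballVol n (τ / 2) := by
      rw [← ballVol_mul zero_le_two, mul_div_cancel₀ τ two_ne_zero]
    have h1 : ballVol n (τ / 2) * (V⁻¹ * X) ^ (q / p) ≤ I := by
      calc ballVol n (τ / 2) * (V⁻¹ * X) ^ (q / p)
          = ∫⁻ _ in closedBall (w + τ • j) (τ / 2), (V⁻¹ * X) ^ (q / p) := by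
            rw [setLIntegral_const, volume_closedBall_eq_ballVol _ (half_pos hτ).le, mul_comm]
        _ ≤ ∫⁻ y in closedBall (w + τ • j) (τ / 2), ballAvg p τ f y ^ q := by
            refine setLIntegral_mono' measurableSet_closedBall fun y hy => ?_
            have : q / p = 1 / p * q := by ring
            rw [this, ENNReal.rpow_mul, ballAvg]
            gcongr
            refine lintegral_mono_set (closedBall_subset_closedBall' ?_)
            rw [dist_comm]
            linarith [mem_closedBall.1 hy]
        _ ≤ I := by
            refine lintegral_mono_set (closedBall_subset_closedBall' ?_)
            rw [dist_eq_norm, add_sub_cancel_left, norm_smul, Real.norm_of_nonneg hτ.le]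
            nlinarith [hT2 j hj]
    have h2 : (V⁻¹ * X) ^ (q / p) ≤ ENNReal.ofReal (2 ^ n) * (V⁻¹ * I) := by
      calc (V⁻¹ * X) ^ (q / p)
          = (V⁻¹ * V) * (V⁻¹ * X) ^ (q / p) := by rw [ENNReal.inv_mul_cancel hV0 hVt, one_mul]
        _ = ENNReal.ofReal (2 ^ n) * (V⁻¹ * (ballVol n (τ / 2) * (V⁻¹ * X) ^ (q / p))) := by
            nth_rw 2 [hVW]; ring
        _ ≤ _ := by gcongr
    have h3 : V⁻¹ * X ≤ (ENNReal.ofReal (2 ^ n) * (V⁻¹ * I)) ^ (p / q) := by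
      rw [← ENNReal.rpow_le_rpow_iff (z := q / p) (by positivity), ← ENNReal.rpow_mul,
        div_mul_div_cancel₀ hq.ne', div_self hp.ne', ENNReal.rpow_one]
      exact h2
    calc X = V * (V⁻¹ * X) := by rw [← mul_assoc, ENNReal.mul_inv_cancel hV0 hVt, one_mul]
      _ ≤ _ := by gcongr
  have hsum : ∫⁻ y in closedBall w (2 * τ), f y ^ p ≤
      T.card * (V * (ENNReal.ofReal (2 ^ n) * (V⁻¹ * I)) ^ (p / q)) := by
    calc ∫⁻ y in closedBall w (2 * τ), f y ^ p
        ≤ ∫⁻ y in ⋃ j : T, closedBall (w + τ • (j : Fin n → ℝ)) (τ / 2), f y ^ p := by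
          refine lintegral_mono_set fun y hy => ?_
          obtain ⟨j, hj, hyj⟩ := hT w y τ hτ hy
          exact mem_iUnion.2 ⟨⟨j, hj⟩, hyj⟩
      _ ≤ ∑ j ∈ T, ∫⁻ y in closedBall (w + τ • j) (τ / 2), f y ^ p := by
          rw [← Finset.tsum_subtype T fun j => ∫⁻ y in closedBall (w + τ • j) (τ / 2), f y ^ p]
          exact lintegral_iUnion_le _ _
      _ ≤ ∑ j ∈ T, V * (ENNReal.ofReal (2 ^ n) * (V⁻¹ * I)) ^ (p / q) :=
          Finset.sum_le_sum hpiece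
      _ = _ := by rw [Finset.sum_const, nsmul_eq_mul]
  calc ballAvg p (2 * τ) f w
      ≤ (V⁻¹ * (T.card * (V * (ENNReal.ofReal (2 ^ n) * (V⁻¹ * I)) ^ (p / q)))) ^ (1 / p) := by
        unfold ballAvg
        gcongr
        exact ballVol_mono hτ.le (by linarith)
    _ = ((T.card * ENNReal.ofReal (2 ^ n) ^ (p / q)) * (V⁻¹ * I) ^ (p / q)) ^ (1 / p) := by
        rw [ENNReal.mul_rpow_of_nonneg (ENNReal.ofReal (2 ^ n)) _ (by positivity)]
        congr 1
        calc _ = (V⁻¹ * V) * (T.card * ENNReal.ofReal (2 ^ n) ^ (p / q) *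
              (V⁻¹ * I) ^ (p / q)) := by ring
          _ = _ := by rw [ENNReal.inv_mul_cancel hV0 hVt, one_mul]
    _ = _ := by
        rw [ENNReal.mul_rpow_of_nonneg _ _ (by positivity), ← ENNReal.rpow_mul (V⁻¹ * I)]
        congr 2
        field_simp

lemma exists_lqNorm_ballAvg_double_le (n : ℕ) {p q s : ℝ} (hp : 0 < p) (hq : 0 < q)
    (hqs : q ≤ s) : ∃ C : ℝ≥0∞, C ≠ ∞ ∧ ∀ τ, 0 < τ → ∀ f : (Fin n → ℝ) → ℝ≥0∞, Measurable f →
      lqNorm s (ballAvg p (2 * τ) f) ≤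
        C * ballVol n τ ^ (1 / s - 1 / q) * lqNorm q (ballAvg p τ f) := by
  have hs : 0 < s := hq.trans_le hqs
  obtain ⟨C, hC, h⟩ := exists_ballAvg_double_le n hp hq
  refine ⟨C * ENNReal.ofReal (3 ^ n) ^ (1 / s), by finiteness, fun τ hτ f hf => ?_⟩
  set V := ballVol n τ
  have hV0 : V ≠ 0 := ballVol_ne_zero hτ
  have hVt : V ≠ ∞ := ballVol_ne_top
  set g : (Fin n → ℝ) → ℝ≥0∞ := ballAvg p τ f
  have hg : Measurable g := measurable_ballAvg p hf measurable_id measurable_const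
  set I : (Fin n → ℝ) → ℝ≥0∞ := fun w => ∫⁻ y in closedBall w (3 * τ), g y ^ q with hI
  have hIm : Measurable I := measurable_setLIntegral_closedBall (F := fun _ y => g y ^ q)
    ((hg.pow_const q).comp measurable_snd) measurable_id measurable_const
  set J := ∫⁻ y, g y ^ q with hJ
  have hsq : 0 ≤ s / q - 1 := by rw [sub_nonneg, one_le_div hq]; exact hqs
  have hInt : ∫⁻ w, ballAvg p (2 * τ) f w ^ s ≤
      C ^ s * V⁻¹ ^ (s / q) * ENNReal.ofReal (3 ^ n) * V * J ^ (s / q) := by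
    calc ∫⁻ w, ballAvg p (2 * τ) f w ^ s
        ≤ ∫⁻ w, C ^ s * V⁻¹ ^ (s / q) * J ^ (s / q - 1) * I w := by
          refine lintegral_mono fun w => ?_
          calc ballAvg p (2 * τ) f w ^ s ≤ (C * (V⁻¹ * I w) ^ (1 / q)) ^ s := by
                gcongr; exact h τ hτ f hf w
            _ = C ^ s * V⁻¹ ^ (s / q) * (I w ^ (s / q - 1) * I w) := by
                have e : I w ^ (s / q - 1) * I w = I w ^ (s / q) := by
                  nth_rw 2 [← ENNReal.rpow_one (I w)]
                  rw [← ENNReal.rpow_add_of_nonneg _ _ hsq zero_le_one, sub_add_cancel]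
                rw [e, ENNReal.mul_rpow_of_nonneg _ _ hs.le, ← ENNReal.rpow_mul,
                  one_div_mul_eq_div, ENNReal.mul_rpow_of_nonneg _ _ (by positivity), mul_assoc]
            _ ≤ C ^ s * V⁻¹ ^ (s / q) * (J ^ (s / q - 1) * I w) := by
                gcongr
                exact setLIntegral_le_lintegral _ _
            _ = _ := by ring
      _ = C ^ s * V⁻¹ ^ (s / q) * J ^ (s / q - 1) * (ENNReal.ofReal (3 ^ n) * V * J) := by
          rw [lintegral_const_mul _ hIm, hI,
            lintegral_setLIntegral_closedBall (hg.pow_const q) (by positivity),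
            ballVol_mul (by norm_num)]
      _ = C ^ s * V⁻¹ ^ (s / q) * ENNReal.ofReal (3 ^ n) * V * (J ^ (s / q - 1) * J ^ (1 : ℝ)) := by
          rw [ENNReal.rpow_one]; ring
      _ = _ := by
          rw [← ENNReal.rpow_add_of_nonneg _ _ hsq zero_le_one, sub_add_cancel]
  calc lqNorm s (ballAvg p (2 * τ) f)
      ≤ (C ^ s * V⁻¹ ^ (s / q) * ENNReal.ofReal (3 ^ n) * V * J ^ (s / q)) ^ (1 / s) := by
        unfold lqNorm; gcongr
    _ = C * V⁻¹ ^ (1 / q) * ENNReal.ofReal (3 ^ n) ^ (1 / s) * V ^ (1 / s) * J ^ (1 / q) := by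
        have e : s / q * (1 / s) = 1 / q := by field_simp
        iterate 4 rw [ENNReal.mul_rpow_of_nonneg _ _ (by positivity)]
        rw [← ENNReal.rpow_mul, ← ENNReal.rpow_mul, ← ENNReal.rpow_mul, e,
          mul_one_div_cancel hs.ne', ENNReal.rpow_one]
    _ = _ := by
        rw [sub_eq_add_neg, ENNReal.rpow_add _ _ hV0 hVt, ENNReal.rpow_neg, ENNReal.inv_rpow,
          lqNorm, hJ]
        ring

end SliceEnlargement

section SliceForm

open Set Filter Topology

variable {n : ℕ}

/-- The weight `D` satisfies a bilinear `L^u` bound on every ball, uniformly in scale. -/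
def ScaleBound (D : (Fin n → ℝ) → (Fin n → ℝ) → ℝ≥0∞) (u : ℝ) (B : ℝ≥0∞) : Prop :=
  ∀ f h : (Fin n → ℝ) → ℝ≥0∞, Measurable f → Measurable h → ∀ z R, 0 < R →
    ∫⁻ x in closedBall z R, ∫⁻ y in closedBall z R, D x y * f y * h x ≤
      B * (ballVol n R * ballAvg u R f z) * (ballVol n R * ballAvg u R h z)

/-- The density at `(R, z)` of the decomposition of the Riesz kernel over balls. -/
def rieszDensity (α : ℝ) (c : ℝ × (Fin n → ℝ)) (a : (Fin n → ℝ) × (Fin n → ℝ)) : ℝ≥0∞ :=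
  ENNReal.ofReal (c.1 ^ (α - 1)) * (ballVol n c.1)⁻¹ ^ 2 *
    (closedBall c.2 c.1 ×ˢ closedBall c.2 c.1).indicator (fun _ => 1) a

lemma measurable_rieszDensity (α : ℝ) :
    Measurable (Function.uncurry (rieszDensity (n := n) α)) := by
  have hs : MeasurableSet {b : (ℝ × (Fin n → ℝ)) × ((Fin n → ℝ) × (Fin n → ℝ)) |
      dist b.2.1 b.1.2 ≤ b.1.1 ∧ dist b.2.2 b.1.2 ≤ b.1.1} := by measurability
  have h1 : Measurable fun b : (ℝ × (Fin n → ℝ)) × ((Fin n → ℝ) × (Fin n → ℝ)) =>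
      ENNReal.ofReal (b.1.1 ^ (α - 1)) := Measurable.ennreal_ofReal (by fun_prop)
  exact (h1.mul ((measurable_ballVol.comp
    (measurable_fst.comp measurable_fst)).inv.pow_const 2)).mul (measurable_const.indicator hs)

lemma measurable_rieszDensity_left (α : ℝ) (a : (Fin n → ℝ) × (Fin n → ℝ)) :
    Measurable fun c => rieszDensity α c a :=
  (measurable_rieszDensity α).of_uncurry_right

lemma rieszKernel_le {α : ℝ} (hαn : α < n) (x y : Fin n → ℝ) :
    ENNReal.ofReal (dist x y ^ (α - n)) ≤ ENNReal.ofReal (4 ^ n * 2 ^ (n + 1 - α)) *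
      ∫⁻ c, rieszDensity α c (x, y) ∂((volume.restrict (Ioi (0 : ℝ))).prod volume) := by
  rcases eq_or_ne x y with rfl | hxy
  · rw [dist_self, Real.zero_rpow (by linarith), ENNReal.ofReal_zero]
    exact zero_le
  set d := dist x y with hd
  have hd0 : 0 < d := dist_pos.2 hxy
  rw [lintegral_prod _ (measurable_rieszDensity_left α (x, y)).aemeasurable]
  have hmain : ∀ R ∈ Ioc d (2 * d), ENNReal.ofReal ((4 ^ n)⁻¹ * (2 * d) ^ (α - 1 - n)) ≤
      ∫⁻ z, rieszDensity α (R, z) (x, y) := by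
    intro R hR
    have hR0 : 0 < R := hd0.trans hR.1
    have hm : closedBall (midpoint ℝ x y) (R / 2) ⊆ {z | dist x z ≤ R ∧ dist y z ≤ R} := by
      intro z hz
      have h1 := mem_closedBall'.1 hz
      have h2 : dist x (midpoint ℝ x y) = d / 2 := by
        rw [dist_left_midpoint, ← hd, Real.norm_ofNat]; ring
      have h3 : dist y (midpoint ℝ x y) = d / 2 := by
        rw [dist_right_midpoint, ← hd, Real.norm_ofNat]; ring
      constructor
      · linarith [dist_triangle x (midpoint ℝ x y) z, hR.1]
      · linarith [dist_triangle y (midpoint ℝ x y) z, hR.1]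
    have hvol : ENNReal.ofReal (R ^ n) ≤
        ∫⁻ z, (closedBall z R ×ˢ closedBall z R).indicator (fun _ => 1) (x, y) := by
      calc ENNReal.ofReal (R ^ n) = ∫⁻ _ in closedBall (midpoint ℝ x y) (R / 2), 1 := by
            rw [setLIntegral_const, volume_closedBall_eq_ballVol _ (half_pos hR0).le, one_mul,
              ballVol, mul_div_cancel₀ R two_ne_zero]
        _ ≤ ∫⁻ z in closedBall (midpoint ℝ x y) (R / 2),
              (closedBall z R ×ˢ closedBall z R).indicator (fun _ => 1) (x, y) := by
            refine setLIntegral_mono' measurableSet_closedBall fun z hz => ?_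
            rw [indicator_of_mem (show (x, y) ∈ closedBall z R ×ˢ closedBall z R from hm hz)]
        _ ≤ _ := setLIntegral_le_lintegral _ _
    have hfin : ENNReal.ofReal (R ^ (α - 1)) * (ballVol n R)⁻¹ ^ 2 ≠ ∞ := by
      have := ballVol_ne_zero (n := n) hR0
      finiteness
    calc ENNReal.ofReal ((4 ^ n)⁻¹ * (2 * d) ^ (α - 1 - n))
        ≤ ENNReal.ofReal ((4 ^ n)⁻¹ * R ^ (α - 1 - n)) := by
          refine ENNReal.ofReal_le_ofReal (mul_le_mul_of_nonneg_left ?_ (by positivity))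
          exact Real.rpow_le_rpow_of_nonpos hR0 hR.2 (by linarith)
      _ = ENNReal.ofReal (R ^ (α - 1)) * (ballVol n R)⁻¹ ^ 2 * ENNReal.ofReal (R ^ n) := by
          rw [ballVol, ← ENNReal.ofReal_inv_of_pos (by positivity),
            ← ENNReal.ofReal_pow (by positivity), ← ENNReal.ofReal_mul (by positivity),
            ← ENNReal.ofReal_mul (by positivity)]
          congr 1
          rw [Real.rpow_sub hR0 (α - 1), Real.rpow_natCast, mul_pow, show (4 : ℝ) = 2 ^ 2 by norm_num,
            ← pow_mul, mul_comm 2 n, pow_mul]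
          field_simp
      _ ≤ ENNReal.ofReal (R ^ (α - 1)) * (ballVol n R)⁻¹ ^ 2 *
            ∫⁻ z, (closedBall z R ×ˢ closedBall z R).indicator (fun _ => 1) (x, y) := by gcongr
      _ = _ := by rw [← lintegral_const_mul' _ _ hfin]; rfl
  calc ENNReal.ofReal (d ^ (α - n))
      = ENNReal.ofReal (4 ^ n * 2 ^ (n + 1 - α)) *
          (ENNReal.ofReal ((4 ^ n)⁻¹ * (2 * d) ^ (α - 1 - n)) * ENNReal.ofReal d) := by
        rw [← ENNReal.ofReal_mul (by positivity), ← ENNReal.ofReal_mul (by positivity)]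
        congr 1
        rw [Real.mul_rpow two_pos.le hd0.le]
        have e1 : (2 : ℝ) ^ (n + 1 - α) * 2 ^ (α - 1 - n) = 1 := by
          rw [← Real.rpow_add two_pos]; ring_nf; exact Real.rpow_zero _
        have e2 : d ^ (α - 1 - n) * d = d ^ (α - n) := by
          nth_rw 2 [← Real.rpow_one d]
          rw [← Real.rpow_add hd0]; ring_nf
        calc d ^ (α - n) = (4 ^ n * (4 ^ n)⁻¹) * ((2 : ℝ) ^ (n + 1 - α) * 2 ^ (α - 1 - n)) *
              (d ^ (α - 1 - n) * d) := by
              rw [e1, e2, mul_inv_cancel₀ (by positivity), one_mul, one_mul]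
          _ = _ := by ring
    _ = ENNReal.ofReal (4 ^ n * 2 ^ (n + 1 - α)) *
          ∫⁻ R in Ioc d (2 * d), ENNReal.ofReal ((4 ^ n)⁻¹ * (2 * d) ^ (α - 1 - n)) := by
        rw [setLIntegral_const, Real.volume_Ioc, two_mul, add_sub_cancel_right]
    _ ≤ ENNReal.ofReal (4 ^ n * 2 ^ (n + 1 - α)) *
          ∫⁻ R in Ioc d (2 * d), ∫⁻ z, rieszDensity α (R, z) (x, y) := by
        gcongr ?_ * ?_
        · exact le_rfl
        · exact setLIntegral_mono' measurableSet_Ioc hmain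
    _ ≤ _ := by
        gcongr
        exact fun R hR => hd0.trans hR.1

lemma lintegral_mul_rieszKernel_le {α u : ℝ} (hαn : α < n)
    {D : (Fin n → ℝ) → (Fin n → ℝ) → ℝ≥0∞} (hD : Measurable (Function.uncurry D)) {B : ℝ≥0∞}
    (hDB : ScaleBound D u B) {f h : (Fin n → ℝ) → ℝ≥0∞} (hf : Measurable f) (hh : Measurable h) :
    ∫⁻ x, ∫⁻ y, D x y * ENNReal.ofReal (dist x y ^ (α - n)) * f y * h x ≤
      ENNReal.ofReal (4 ^ n * 2 ^ (n + 1 - α)) * B * ∫⁻ R in Ioi (0 : ℝ),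
        ENNReal.ofReal (R ^ (α - 1)) * ∫⁻ z, ballAvg u R f z * ballAvg u R h z := by
  set C := ENNReal.ofReal (4 ^ n * 2 ^ (n + 1 - α))
  set μ : Measure (ℝ × (Fin n → ℝ)) := (volume.restrict (Ioi (0 : ℝ))).prod volume
  set F : (Fin n → ℝ) × (Fin n → ℝ) → ℝ≥0∞ := fun a => D a.1 a.2 * f a.2 * h a.1 with hF
  have hFm : Measurable F :=
    (hD.mul (hf.comp measurable_snd)).mul (hh.comp measurable_fst)
  have hΦ := measurable_rieszDensity (n := n) α
  have hΨ : Measurable fun b : ((Fin n → ℝ) × (Fin n → ℝ)) × (ℝ × (Fin n → ℝ)) =>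
      F b.1 * rieszDensity α b.2 b.1 := by
    have h1 := hΦ.comp (measurable_snd.prodMk measurable_fst :
      Measurable fun b : ((Fin n → ℝ) × (Fin n → ℝ)) × (ℝ × (Fin n → ℝ)) => (b.2, b.1))
    exact (hFm.comp measurable_fst).mul h1
  clear_value F
  calc ∫⁻ x, ∫⁻ y, D x y * ENNReal.ofReal (dist x y ^ (α - n)) * f y * h x
      ≤ ∫⁻ x, ∫⁻ y, C * ∫⁻ c, F (x, y) * rieszDensity α c (x, y) ∂μ := by
        refine lintegral_mono fun x => lintegral_mono fun y => ?_
        rw [lintegral_const_mul _ (measurable_rieszDensity_left α (x, y))]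
        calc D x y * ENNReal.ofReal (dist x y ^ (α - n)) * f y * h x
            ≤ D x y * (C * ∫⁻ c, rieszDensity α c (x, y) ∂μ) * f y * h x := by
              gcongr
              exact rieszKernel_le hαn x y
          _ = _ := by simp only [hF]; ring
    _ = C * ∫⁻ a, ∫⁻ c, F a * rieszDensity α c a ∂μ := by
        rw [← lintegral_const_mul _ hΨ.lintegral_prod_right', Measure.volume_eq_prod,
          lintegral_prod _ (hΨ.lintegral_prod_right'.const_mul C).aemeasurable]
    _ = C * ∫⁻ c, (∫⁻ a, F a * rieszDensity α c a) ∂μ := by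
        rw [lintegral_lintegral_swap hΨ.aemeasurable]
    _ = C * ∫⁻ R in Ioi (0 : ℝ), ∫⁻ z, ∫⁻ a, F a * rieszDensity α (R, z) a := by
        rw [lintegral_prod]
        exact (hΨ.comp measurable_swap).lintegral_prod_right'.aemeasurable
    _ ≤ C * ∫⁻ R in Ioi (0 : ℝ), ∫⁻ z,
          B * (ENNReal.ofReal (R ^ (α - 1)) * (ballAvg u R f z * ballAvg u R h z)) := by
        refine mul_le_mul_right ?_ C
        refine setLIntegral_mono' measurableSet_Ioi fun R hR => lintegral_mono fun z => ?_
        have hind : ∀ a, F a * rieszDensity α (R, z) a =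
            ENNReal.ofReal (R ^ (α - 1)) * (ballVol n R)⁻¹ ^ 2 *
              (closedBall z R ×ˢ closedBall z R).indicator F a := by
          intro a
          unfold rieszDensity
          by_cases ha : a ∈ closedBall z R ×ˢ closedBall z R
          · rw [indicator_of_mem ha, indicator_of_mem ha]; ring
          · rw [indicator_of_notMem ha, indicator_of_notMem ha]; simp
        have hms : MeasurableSet (closedBall z R ×ˢ closedBall z R) :=
          measurableSet_closedBall.prod measurableSet_closedBall
        calc ∫⁻ a, F a * rieszDensity α (R, z) a
            = ENNReal.ofReal (R ^ (α - 1)) * (ballVol n R)⁻¹ ^ 2 *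
                ∫⁻ x in closedBall z R, ∫⁻ y in closedBall z R, D x y * f y * h x := by
              simp_rw [hind]
              rw [lintegral_const_mul _ (hFm.indicator hms), lintegral_indicator hms,
                Measure.volume_eq_prod, ← Measure.prod_restrict,
                lintegral_prod _ hFm.aemeasurable, hF]
          _ ≤ ENNReal.ofReal (R ^ (α - 1)) * (ballVol n R)⁻¹ ^ 2 *
                (B * (ballVol n R * ballAvg u R f z) * (ballVol n R * ballAvg u R h z)) := by
              gcongr
              exact hDB f h hf hh z R hR
          _ = ((ballVol n R)⁻¹ * ballVol n R) ^ 2 *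
                (B * (ENNReal.ofReal (R ^ (α - 1)) * (ballAvg u R f z * ballAvg u R h z))) := by
              ring
          _ = _ := by rw [ballVol_inv_mul_cancel hR, one_pow, one_mul]
    _ = _ := by
        have h1 : ∀ k : (Fin n → ℝ) → ℝ≥0∞, Measurable k →
            Measurable fun b : ℝ × (Fin n → ℝ) => ballAvg u b.1 k b.2 := fun k hk =>
          measurable_ballAvg u hk measurable_snd measurable_fst
        have h2 : Measurable fun b : ℝ × (Fin n → ℝ) =>
            ballAvg u b.1 f b.2 * ballAvg u b.1 h b.2 := (h1 f hf).mul (h1 h hh)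
        have h3 : Measurable fun R : ℝ => ENNReal.ofReal (R ^ (α - 1)) :=
          Measurable.ennreal_ofReal (by fun_prop)
        have h4 : ∀ R : ℝ, ∫⁻ z,
            B * (ENNReal.ofReal (R ^ (α - 1)) * (ballAvg u R f z * ballAvg u R h z)) =
            B * (ENNReal.ofReal (R ^ (α - 1)) * ∫⁻ z, ballAvg u R f z * ballAvg u R h z) := by
          intro R
          have h5 : Measurable fun z => ballAvg u R f z * ballAvg u R h z :=
            (measurable_ballAvg u hf measurable_id measurable_const).mul
              (measurable_ballAvg u hh measurable_id measurable_const)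
          rw [lintegral_const_mul _ (h5.const_mul _)]
          congr 1
          exact lintegral_const_mul _ h5
        simp_rw [h4]
        have h6 : Measurable fun R : ℝ => ENNReal.ofReal (R ^ (α - 1)) *
            ∫⁻ z, ballAvg u R f z * ballAvg u R h z := h3.mul h2.lintegral_prod_right'
        rw [lintegral_const_mul _ h6, mul_assoc]

end SliceForm

section SliceFormBound

open Set Filter Topology

variable {n : ℕ}

lemma ballAvg_le_two_mul {u R : ℝ} (hu : 0 < u) (hR : 0 < R) (f : (Fin n → ℝ) → ℝ≥0∞)
    (z : Fin n → ℝ) :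
    ballAvg u R f z ≤ ENNReal.ofReal (2 ^ n) ^ (1 / u) * ballAvg u (2 * R) f z :=
  ballAvg_le_of_subset hu hR (by linarith) zero_le_two le_rfl f z

lemma ballAvg_le_ballAvg_ballAvg {u p τ R : ℝ} (hu : 0 < u) (hup : u ≤ p) (hτ : 0 < τ)
    (hτR : τ ≤ R) {f : (Fin n → ℝ) → ℝ≥0∞} (hf : Measurable f) (z : Fin n → ℝ) :
    ballAvg u R f z ≤ ENNReal.ofReal (2 ^ n) ^ (1 / u) * ballAvg u (2 * R) (ballAvg p τ f) z := by
  have hR : 0 < R := hτ.trans_le hτR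
  rw [ballAvg, ballAvg, ← ENNReal.mul_rpow_of_nonneg _ _ (by positivity)]
  refine ENNReal.rpow_le_rpow ?_ (by positivity)
  have hV : (ballVol n R)⁻¹ = ENNReal.ofReal (2 ^ n) * (ballVol n (2 * R))⁻¹ := by
    rw [ballVol_mul zero_le_two, ENNReal.mul_inv (by simp) (by simp), ← mul_assoc,
      ENNReal.mul_inv_cancel (by simp) (by simp), one_mul]
  rw [hV, mul_assoc]
  refine mul_le_mul_right (mul_le_mul_right ?_ _) _
  refine (setLIntegral_closedBall_le_avg (hf.pow_const u) z R hτ).trans ?_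
  refine (lintegral_mono_set (closedBall_subset_closedBall (by linarith : R + τ ≤ 2 * R))).trans ?_
  refine lintegral_mono fun w => ?_
  rw [← ballAvg_rpow hu]
  gcongr
  exact ballAvg_mono_exponent hu hup hτ hf w

lemma ballAvg_indicator_of_subset {u R : ℝ} (f : (Fin n → ℝ) → ℝ≥0∞) {z : Fin n → ℝ}
    {s : Set (Fin n → ℝ)} (hs : closedBall z R ⊆ s) :
    ballAvg u R f z = ballAvg u R (s.indicator f) z := by
  unfold ballAvg
  congr 2
  refine setLIntegral_congr_fun measurableSet_closedBall fun y hy => ?_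
  simp only [indicator_of_mem (hs hy)]

lemma lqNorm_indicator_closedBall {p R : ℝ} (hp : 0 < p) (hR : 0 < R) (f : (Fin n → ℝ) → ℝ≥0∞)
    (w : Fin n → ℝ) :
    lqNorm p ((closedBall w R).indicator f) = ballVol n R ^ (1 / p) * ballAvg p R f w := by
  rw [ballAvg, ← ENNReal.mul_rpow_of_nonneg _ _ (by positivity), ← mul_assoc,
    ENNReal.mul_inv_cancel (ballVol_ne_zero hR) ballVol_ne_top, one_mul, lqNorm,
    ← lintegral_indicator measurableSet_closedBall]
  congr 2
  ext y
  by_cases hy : y ∈ closedBall w R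
  · simp [hy]
  · simp [hy, hp]

lemma exists_slice_form_le (hn : n ≠ 0) {α p q r r' s s' u : ℝ} (hα : 0 < α)
    (hpr : α / n = 1 / p - 1 / r) (hqs : α / n = 1 / q - 1 / s) (hr : r.HolderConjugate r')
    (hs : s.HolderConjugate s') (hu : 0 < u) (hup : u < p) (huq : u < q) (hur : u < r')
    (hus : u < s') : ∃ C : ℝ≥0∞, C ≠ ∞ ∧ ∀ τ, 0 < τ →
      ∀ f h : (Fin n → ℝ) → ℝ≥0∞, Measurable f → Measurable h →
        ∫⁻ R in Ioi (0 : ℝ), ENNReal.ofReal (R ^ (α - 1)) *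
            ∫⁻ z, ballAvg u R f z * ballAvg u R h z ≤
          C * lqNorm q (ballAvg p τ f) * lqNorm s' (ballAvg r' τ h) := by
  have hp : 0 < p := hu.trans hup
  have hq : 0 < q := hu.trans huq
  have hr'0 : 0 < r' := hr.symm.pos
  have hs0 := hs.pos
  have hqs_le : q ≤ s := by
    have : 0 < α / n := by positivity
    rw [hqs, sub_pos] at this
    exact (lt_of_one_div_lt_one_div hs0 this).le
  obtain ⟨C₁, hC₁, hloc⟩ := exists_scale_form_le hn hα hpr hr hu hup hur
  obtain ⟨C₂, hC₂, hglob⟩ := exists_scale_form_le hn hα hqs hs hu huq hus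
  obtain ⟨C₃, hC₃, hf3⟩ := exists_lqNorm_ballAvg_double_le n hp hq hqs_le
  obtain ⟨C₄, hC₄, hh4⟩ := exists_lqNorm_ballAvg_double_le n hr'0 hs.symm.pos le_rfl
  set c := ENNReal.ofReal (2 ^ n) ^ (1 / u)
  set e := ENNReal.ofReal (2 ^ n) ^ (1 / p + 1 / r')
  refine ⟨c ^ 2 * C₁ * e * C₃ * C₄ + c ^ 2 * C₂, by finiteness, fun τ hτ f h hf hh => ?_⟩
  set g : (Fin n → ℝ) → ℝ≥0∞ := ballAvg p τ f
  set H : (Fin n → ℝ) → ℝ≥0∞ := ballAvg r' τ h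
  have hg : Measurable g := measurable_ballAvg p hf measurable_id measurable_const
  have hH : Measurable H := measurable_ballAvg r' hh measurable_id measurable_const
  have hV0 : ballVol n τ ≠ 0 := ballVol_ne_zero hτ
  have hVt : ballVol n τ ≠ ∞ := ballVol_ne_top
  set Θ : ℝ → (Fin n → ℝ) → ℝ≥0∞ := fun R z =>
    ENNReal.ofReal (R ^ (α - 1)) * (ballAvg u R f z * ballAvg u R h z) with hΘ
  have hΘm : Measurable (Function.uncurry Θ) := by
    have h1 : Measurable fun b : ℝ × (Fin n → ℝ) => ENNReal.ofReal (b.1 ^ (α - 1)) :=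
      Measurable.ennreal_ofReal (by fun_prop)
    exact h1.mul ((measurable_ballAvg u hf measurable_snd measurable_fst).mul
      (measurable_ballAvg u hh measurable_snd measurable_fst))
  have hsmall : ∫⁻ R in Ioc 0 τ, ENNReal.ofReal (R ^ (α - 1)) *
      ∫⁻ z, ballAvg u R f z * ballAvg u R h z ≤
      c ^ 2 * C₁ * e * C₃ * C₄ * lqNorm q g * lqNorm s' H := by
    have hw : ∀ w, ∫⁻ z in closedBall w τ, ∫⁻ R in Ioc 0 τ, Θ R z ≤
        c ^ 2 * C₁ * (e * ballVol n τ ^ (1 / p + 1 / r')) *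
          (ballAvg p (2 * τ) f w * ballAvg r' (2 * τ) h w) := by
      intro w
      set fw := (closedBall w (2 * τ)).indicator f
      set hw := (closedBall w (2 * τ)).indicator h
      have hfw : Measurable fw := hf.indicator measurableSet_closedBall
      have hhw : Measurable hw := hh.indicator measurableSet_closedBall
      calc ∫⁻ z in closedBall w τ, ∫⁻ R in Ioc 0 τ, Θ R z
          = ∫⁻ R in Ioc 0 τ, ∫⁻ z in closedBall w τ, Θ R z :=
            (lintegral_lintegral_swap hΘm.aemeasurable).symm
        _ ≤ ∫⁻ R in Ioc 0 τ, c ^ 2 * (ENNReal.ofReal (R ^ (α - 1)) *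
              ∫⁻ z, ballAvg u (2 * R) fw z * ballAvg u (2 * R) hw z) := by
            refine setLIntegral_mono' measurableSet_Ioc fun R hR => ?_
            have hc : c ^ 2 * ENNReal.ofReal (R ^ (α - 1)) ≠ ∞ := by finiteness
            rw [← mul_assoc, ← lintegral_const_mul' _ _ hc]
            refine (setLIntegral_mono' measurableSet_closedBall fun z hz => ?_).trans
              (setLIntegral_le_lintegral (closedBall w τ) _)
            have hsub : closedBall z R ⊆ closedBall w (2 * τ) := closedBall_subset_closedBall' (by
              linarith [mem_closedBall.1 hz, hR.2])
            calc Θ R z = ENNReal.ofReal (R ^ (α - 1)) * (ballAvg u R fw z * ballAvg u R hw z) := by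
                  simp only [hΘ]
                  rw [ballAvg_indicator_of_subset f hsub, ballAvg_indicator_of_subset h hsub]
              _ ≤ ENNReal.ofReal (R ^ (α - 1)) *
                    ((c * ballAvg u (2 * R) fw z) * (c * ballAvg u (2 * R) hw z)) := by
                  gcongr
                  · exact ballAvg_le_two_mul hu hR.1 fw z
                  · exact ballAvg_le_two_mul hu hR.1 hw z
              _ = _ := by ring
        _ = c ^ 2 * ∫⁻ R in Ioc 0 τ, ENNReal.ofReal (R ^ (α - 1)) *
              ∫⁻ z, ballAvg u (2 * R) fw z * ballAvg u (2 * R) hw z :=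
            lintegral_const_mul' _ _ (by finiteness)
        _ ≤ c ^ 2 * ∫⁻ R in Ioi 0, ENNReal.ofReal (R ^ (α - 1)) *
              ∫⁻ z, ballAvg u (2 * R) fw z * ballAvg u (2 * R) hw z := by
            gcongr
            exact Ioc_subset_Ioi_self
        _ ≤ c ^ 2 * (C₁ * lqNorm p fw * lqNorm r' hw) := by
            gcongr
            exact hloc fw hw hfw hhw
        _ = c ^ 2 * C₁ * (ballVol n (2 * τ) ^ (1 / p) * ballVol n (2 * τ) ^ (1 / r')) *
              (ballAvg p (2 * τ) f w * ballAvg r' (2 * τ) h w) := by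
            rw [lqNorm_indicator_closedBall hp (by positivity),
              lqNorm_indicator_closedBall hr'0 (by positivity)]
            ring
        _ = _ := by
            rw [← ENNReal.rpow_add _ _ (ballVol_ne_zero (by positivity)) ballVol_ne_top,
              ballVol_mul zero_le_two, ENNReal.mul_rpow_of_nonneg _ _ (by positivity)]
    have hm1 : Measurable (ballAvg p (2 * τ) f) :=
      measurable_ballAvg p hf measurable_id measurable_const
    have hm2 : Measurable (ballAvg r' (2 * τ) h) :=
      measurable_ballAvg r' hh measurable_id measurable_const
    have hΘz : Measurable fun z => ∫⁻ R in Ioc 0 τ, Θ R z := hΘm.lintegral_prod_left'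
    calc ∫⁻ R in Ioc 0 τ, ENNReal.ofReal (R ^ (α - 1)) *
          ∫⁻ z, ballAvg u R f z * ballAvg u R h z
        = ∫⁻ R in Ioc 0 τ, ∫⁻ z, Θ R z := by
          refine lintegral_congr fun R => ?_
          rw [← lintegral_const_mul' _ _ ENNReal.ofReal_ne_top]
      _ = ∫⁻ z, ∫⁻ R in Ioc 0 τ, Θ R z := lintegral_lintegral_swap hΘm.aemeasurable
      _ = (ballVol n τ)⁻¹ * ∫⁻ w, ∫⁻ z in closedBall w τ, ∫⁻ R in Ioc 0 τ, Θ R z := by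
          rw [lintegral_setLIntegral_closedBall hΘz hτ.le, ← mul_assoc,
            ballVol_inv_mul_cancel hτ, one_mul]
      _ ≤ (ballVol n τ)⁻¹ * ∫⁻ w, c ^ 2 * C₁ * (e * ballVol n τ ^ (1 / p + 1 / r')) *
            (ballAvg p (2 * τ) f w * ballAvg r' (2 * τ) h w) := by
          gcongr with w
          exact hw w
      _ = (ballVol n τ)⁻¹ * (c ^ 2 * C₁ * (e * ballVol n τ ^ (1 / p + 1 / r')) *
            ∫⁻ w, ballAvg p (2 * τ) f w * ballAvg r' (2 * τ) h w) := by
          rw [lintegral_const_mul _ (by fun_prop)]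
      _ ≤ (ballVol n τ)⁻¹ * (c ^ 2 * C₁ * (e * ballVol n τ ^ (1 / p + 1 / r')) *
            ((C₃ * ballVol n τ ^ (1 / s - 1 / q) * lqNorm q g) *
              (C₄ * ballVol n τ ^ (1 / s' - 1 / s') * lqNorm s' H))) := by
          gcongr
          refine (lintegral_mul_le_lqNorm hs hm1 hm2).trans ?_
          gcongr
          · exact hf3 τ hτ f hf
          · exact hh4 τ hτ h hh
      _ = c ^ 2 * C₁ * e * C₃ * C₄ * lqNorm q g * lqNorm s' H *
            (ballVol n τ ^ (-1 : ℝ) * ballVol n τ ^ (1 / p + 1 / r') *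
              ballVol n τ ^ (1 / s - 1 / q)) := by
          rw [sub_self, ENNReal.rpow_zero, ENNReal.rpow_neg_one]
          ring
      _ = _ := by
          have hexp : -1 + (1 / p + 1 / r') + (1 / s - 1 / q) = 0 := by
            have h1 := hr.inv_add_inv_eq_one
            rw [← one_div, ← one_div] at h1
            linarith [hpr.symm.trans hqs]
          rw [← ENNReal.rpow_add _ _ hV0 hVt, ← ENNReal.rpow_add _ _ hV0 hVt, hexp,
            ENNReal.rpow_zero, mul_one]
  have hlarge : ∫⁻ R in Ioi τ, ENNReal.ofReal (R ^ (α - 1)) *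
      ∫⁻ z, ballAvg u R f z * ballAvg u R h z ≤ c ^ 2 * C₂ * lqNorm q g * lqNorm s' H := by
    calc ∫⁻ R in Ioi τ, ENNReal.ofReal (R ^ (α - 1)) * ∫⁻ z, ballAvg u R f z * ballAvg u R h z
        ≤ ∫⁻ R in Ioi τ, c ^ 2 * (ENNReal.ofReal (R ^ (α - 1)) *
            ∫⁻ z, ballAvg u (2 * R) g z * ballAvg u (2 * R) H z) := by
          refine setLIntegral_mono' measurableSet_Ioi fun R hR => ?_
          rw [mul_left_comm]
          gcongr
          rw [← lintegral_const_mul' _ _ (by finiteness)]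
          refine lintegral_mono fun z => ?_
          calc ballAvg u R f z * ballAvg u R h z
              ≤ (c * ballAvg u (2 * R) g z) * (c * ballAvg u (2 * R) H z) := by
                gcongr
                · exact ballAvg_le_ballAvg_ballAvg hu hup.le hτ (le_of_lt hR) hf z
                · exact ballAvg_le_ballAvg_ballAvg hu hur.le hτ (le_of_lt hR) hh z
            _ = _ := by ring
      _ = c ^ 2 * ∫⁻ R in Ioi τ, ENNReal.ofReal (R ^ (α - 1)) *
            ∫⁻ z, ballAvg u (2 * R) g z * ballAvg u (2 * R) H z :=
          lintegral_const_mul' _ _ (by finiteness)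
      _ ≤ c ^ 2 * ∫⁻ R in Ioi 0, ENNReal.ofReal (R ^ (α - 1)) *
            ∫⁻ z, ballAvg u (2 * R) g z * ballAvg u (2 * R) H z := by
          gcongr
      _ ≤ c ^ 2 * (C₂ * lqNorm q g * lqNorm s' H) := by
          gcongr
          exact hglob g H hg hH
      _ = _ := by ring
  rw [← Ioc_union_Ioi_eq_Ioi hτ.le, add_mul, add_mul]
  exact (lintegral_union_le _ _ _).trans (add_le_add hsmall hlarge)

end SliceFormBound

section SliceDuality

open Set Filter Topology

variable {n : ℕ}

lemma ENNReal.iSup_rpow {ι : Sort*} {u : ℝ} (hu : 0 < u) (a : ι → ℝ≥0∞) :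
    (⨆ i, a i) ^ u = ⨆ i, a i ^ u :=
  (ENNReal.orderIsoRpow u hu).map_iSup a

lemma ballAvg_iSup {u : ℝ} (hu : 0 < u) (R : ℝ) {g : ℕ → (Fin n → ℝ) → ℝ≥0∞}
    (hg : ∀ N, Measurable (g N)) (hmono : Monotone g) (z : Fin n → ℝ) :
    ballAvg u R (fun y => ⨆ N, g N y) z = ⨆ N, ballAvg u R (g N) z := by
  simp only [ballAvg]
  rw [← ENNReal.iSup_rpow (by positivity), ← ENNReal.mul_iSup]
  congr 2
  rw [← lintegral_iSup (fun N => (hg N).pow_const u)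
    (fun N M h y => ENNReal.rpow_le_rpow (hmono h y) hu.le)]
  simp only [ENNReal.iSup_rpow hu]

lemma lqNorm_iSup {q : ℝ} (hq : 0 < q) {g : ℕ → (Fin n → ℝ) → ℝ≥0∞}
    (hg : ∀ N, Measurable (g N)) (hmono : Monotone g) :
    lqNorm q (fun y => ⨆ N, g N y) = ⨆ N, lqNorm q (g N) := by
  simp only [lqNorm]
  rw [← ENNReal.iSup_rpow (by positivity)]
  congr 1
  rw [← lintegral_iSup (fun N => (hg N).pow_const q)
    (fun N M h y => ENNReal.rpow_le_rpow (hmono h y) hq.le)]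
  simp only [ENNReal.iSup_rpow hq]

lemma lqNorm_mono {q : ℝ} (hq : 0 < q) {f g : (Fin n → ℝ) → ℝ≥0∞} (h : ∀ x, f x ≤ g x) :
    lqNorm q f ≤ lqNorm q g :=
  ENNReal.rpow_le_rpow (lintegral_mono fun x => ENNReal.rpow_le_rpow (h x) hq.le) (by positivity)

lemma lqNorm_ballAvg_self {q R : ℝ} (hq : 0 < q) (hR : 0 < R) {f : (Fin n → ℝ) → ℝ≥0∞}
    (hf : Measurable f) : lqNorm q (ballAvg q R f) = lqNorm q f := by
  simp only [lqNorm]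
  congr 1
  simp only [ballAvg_rpow hq]
  rw [lintegral_const_mul' _ _ (by simp [ballVol_ne_zero hR]),
    lintegral_setLIntegral_closedBall (hf.pow_const q) hR.le, ← mul_assoc,
    ballVol_inv_mul_cancel hR, one_mul]

/-- The function realizing the duality between the slice norms with exponents `(r, s)` and
`(r', s')`. -/
lemma exists_dual_function {r r' s s' τ : ℝ} (hr : r.HolderConjugate r')
    (hs : s.HolderConjugate s') (hτ : 0 < τ) {g : (Fin n → ℝ) → ℝ≥0∞} (hg : Measurable g)
    (hA : ∀ z, ballAvg r τ g z ≠ ∞) :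
    ∃ h : (Fin n → ℝ) → ℝ≥0∞, Measurable h ∧
      ∫⁻ y, g y * h y = ∫⁻ z, ballAvg r τ g z ^ s ∧
      lqNorm s' (ballAvg r' τ h) ≤
        ENNReal.ofReal (2 ^ n) * (∫⁻ z, ballAvg r τ g z ^ s) ^ (1 / s') := by
  classical
  set A : (Fin n → ℝ) → ℝ≥0∞ := ballAvg r τ g with hAdef
  have hAm : Measurable A := measurable_ballAvg r hg measurable_id measurable_const
  have hr0 := hr.pos
  have hr'0 := hr.symm.pos
  have hs0 := hs.pos
  have hs'0 := hs.symm.pos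
  have hV0 := ballVol_ne_zero (n := n) hτ
  set V := ballVol n τ
  have hVt : V ≠ ∞ := ballVol_ne_top
  have hA0 : MeasurableSet {z | A z = 0} := hAm (measurableSet_singleton 0)
  set W : ℝ → (Fin n → ℝ) → ℝ≥0∞ := fun e z => if A z = 0 then 0 else A z ^ e with hW
  have hWm : ∀ e, Measurable (W e) := fun e =>
    Measurable.ite hA0 measurable_const (hAm.pow_const e)
  have hWA : ∀ e z, 0 < e + r → W e z * A z ^ r = A z ^ (e + r) := by
    intro e z he
    by_cases h0 : A z = 0
    · simp [hW, h0, he]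
    · simp only [hW, h0, if_false]
      rw [ENNReal.rpow_add _ _ h0 (hA z)]
  have hAr : ∀ z, A z ^ r = V⁻¹ * ∫⁻ y in closedBall z τ, g y ^ r := fun z =>
    ballAvg_rpow hr0 τ g z
  have hI : ∀ e, Measurable fun y => ∫⁻ x in closedBall y τ, W e x := fun e =>
    measurable_setLIntegral_closedBall (F := fun _ x => W e x) ((hWm e).comp measurable_snd)
      measurable_id measurable_const
  have hF : ∀ e, Measurable (Function.uncurry fun y x : Fin n → ℝ => g y ^ r * W e x) := fun e =>
    ((hg.pow_const r).comp measurable_fst).mul ((hWm e).comp measurable_snd)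
  have hinner : ∀ e x, ∫⁻ y in closedBall x τ, g y ^ r * W e x = V * (W e x * A x ^ r) := by
    intro e x
    rw [lintegral_mul_const _ (hg.pow_const r), hAr, mul_left_comm (W e x), ← mul_assoc,
      ENNReal.mul_inv_cancel hV0 hVt, one_mul, mul_comm]
  set h : (Fin n → ℝ) → ℝ≥0∞ := fun y => g y ^ (r - 1) * (V⁻¹ * ∫⁻ x in closedBall y τ, W (s - r) x)
    with hh
  have hhm : Measurable h := (hg.pow_const _).mul ((hI _).const_mul _)
  refine ⟨h, hhm, ?_, ?_⟩
  · have h1 : ∀ y, g y * h y = V⁻¹ * ∫⁻ x in closedBall y τ, g y ^ r * W (s - r) x := by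
      intro y
      rw [lintegral_const_mul _ (hWm _)]
      have : g y ^ r = g y * g y ^ (r - 1) := by
        conv_rhs => rw [← ENNReal.rpow_one (g y), ← ENNReal.rpow_mul, one_mul]
        rw [← ENNReal.rpow_add_of_nonneg _ _ zero_le_one (by have := hr.lt; linarith)]
        ring_nf
      rw [this, hh]
      ring
    simp only [h1]
    rw [lintegral_const_mul' _ _ (by simp [hV0]), lintegral_closedBall_swap (hF _)]
    simp only [hinner]
    rw [lintegral_const_mul' _ _ hVt, ← mul_assoc, ENNReal.inv_mul_cancel hV0 hVt, one_mul]
    refine lintegral_congr fun x => ?_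
    rw [hWA _ _ (by linarith)]
    ring_nf
  · set M : (Fin n → ℝ) → ℝ≥0∞ := fun z => V⁻¹ * ∫⁻ x in closedBall z (2 * τ), A x ^ (s - 1)
      with hM
    have hs1 : 0 < s - 1 := by have := hs.lt; linarith
    have hbound : ∀ z, ballAvg r' τ h z ≤ M z := by
      intro z
      have hpt : ∀ y ∈ closedBall z τ, h y ^ r' ≤
          M z ^ (r' / r) * (V⁻¹ * ∫⁻ x in closedBall y τ, g y ^ r * W (s - 1 - r) x) := by
        intro y hy
        have hfac : ∀ x, W (s - r) x = A x ^ ((s - 1) / r) * W (s - 1 - r) x ^ (1 / r') := by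
          intro x
          by_cases h0 : A x = 0
          · simp [hW, h0, hr'0]
          · simp only [hW, h0, if_false]
            rw [← ENNReal.rpow_mul, ← ENNReal.rpow_add _ _ h0 (hA x)]
            congr 1
            have := hr.inv_add_inv_eq_one
            have e1 : r'⁻¹ = 1 - r⁻¹ := by linarith
            rw [one_div, e1]
            field_simp
            ring
        have h1 : V⁻¹ * ∫⁻ x in closedBall y τ, W (s - r) x ≤
            M z ^ (1 / r) * (V⁻¹ * ∫⁻ x in closedBall y τ, W (s - 1 - r) x) ^ (1 / r') := by
          simp only [hfac]
          refine (mul_le_mul_right (setLIntegral_mul_le_ballAvg hr hτ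
            (hAm.pow_const _) ((hWm _).pow_const _) y) V⁻¹).trans ?_
          rw [mul_assoc, ← mul_assoc, ENNReal.inv_mul_cancel hV0 hVt, one_mul]
          refine mul_le_mul' ?_ ?_
          · refine ENNReal.rpow_le_rpow (mul_le_mul_right ?_ _) (by positivity)
            have : ∀ x, (A x ^ ((s - 1) / r)) ^ r = A x ^ (s - 1) := by
              intro x
              rw [← ENNReal.rpow_mul, div_mul_cancel₀ _ hr0.ne']
            simp only [this]
            refine lintegral_mono_set (closedBall_subset_closedBall' ?_)
            have := mem_closedBall.1 hy
            linarith
          · refine ENNReal.rpow_le_rpow (mul_le_mul_right ?_ _) (by positivity)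
            have : ∀ x, (W (s - 1 - r) x ^ (1 / r')) ^ r' = W (s - 1 - r) x := by
              intro x
              rw [← ENNReal.rpow_mul, one_div_mul_cancel hr'0.ne', ENNReal.rpow_one]
            simp only [this]
            exact le_rfl
        have h2 := ENNReal.rpow_le_rpow (mul_le_mul_right h1 (g y ^ (r - 1))) hr'0.le
        refine h2.trans_eq ?_
        rw [ENNReal.mul_rpow_of_nonneg _ _ hr'0.le, ENNReal.mul_rpow_of_nonneg _ _ hr'0.le,
          ← ENNReal.rpow_mul, ← ENNReal.rpow_mul, ← ENNReal.rpow_mul,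
          one_div_mul_cancel hr'0.ne', ENNReal.rpow_one, lintegral_const_mul _ (hWm _),
          hr.sub_one_mul_conj]
        have : 1 / r * r' = r' / r := by ring
        rw [this]
        ring
      have h3 : ∫⁻ y in closedBall z τ, h y ^ r' ≤ M z ^ (r' / r) * (V * M z) := by
        refine (setLIntegral_mono' measurableSet_closedBall hpt).trans ?_
        have hm2 : Measurable fun y => ∫⁻ x in closedBall y τ, g y ^ r * W (s - 1 - r) x :=
          measurable_setLIntegral_closedBall (hF _) measurable_id measurable_const
        rw [lintegral_const_mul _ (hm2.const_mul _), lintegral_const_mul _ hm2]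
        refine mul_le_mul_right ?_ _
        refine (mul_le_mul_right (setLIntegral_closedBall_swap_le (hF _) z τ τ) _).trans ?_
        simp only [hinner]
        rw [lintegral_const_mul' _ _ hVt, ← mul_assoc, ENNReal.inv_mul_cancel hV0 hVt, one_mul, hM,
          ← mul_assoc, ENNReal.mul_inv_cancel hV0 hVt, one_mul, two_mul]
        refine lintegral_mono fun x => ?_
        rw [hWA _ _ (by linarith)]
        simp
      rw [ballAvg]
      calc (V⁻¹ * ∫⁻ y in closedBall z τ, h y ^ r') ^ (1 / r')
          ≤ (V⁻¹ * (M z ^ (r' / r) * (V * M z))) ^ (1 / r') :=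
            ENNReal.rpow_le_rpow (mul_le_mul_right h3 _) (by positivity)
        _ = (M z ^ (r' / r) * M z ^ (1 : ℝ)) ^ (1 / r') := by
            rw [mul_left_comm, ← mul_assoc V⁻¹, ENNReal.inv_mul_cancel hV0 hVt, one_mul,
              ENNReal.rpow_one]
        _ = M z := by
            rw [← ENNReal.rpow_add_of_nonneg _ _ (by positivity) zero_le_one, ← ENNReal.rpow_mul]
            have : (r' / r + 1) * (1 / r') = 1 := by
              refine Eq.trans ?_ hr.inv_add_inv_eq_one
              field_simp
            rw [this, ENNReal.rpow_one]
    have hM2 : ∀ z, M z ≤ ENNReal.ofReal (2 ^ n) * ballAvg s' (2 * τ) (fun x => A x ^ (s - 1)) z := by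
      intro z
      refine (mul_le_mul_right (setLIntegral_le_ballAvg hs.symm.lt.le (by positivity)
        (hAm.pow_const _) z) _).trans_eq ?_
      rw [ballVol_mul zero_le_two, ← mul_assoc, mul_left_comm, ENNReal.inv_mul_cancel hV0 hVt,
        mul_one]
    refine (lqNorm_mono hs'0 fun z => (hbound z).trans (hM2 z)).trans_eq ?_
    have hconst : lqNorm s' (fun z => ENNReal.ofReal (2 ^ n) *
        ballAvg s' (2 * τ) (fun x => A x ^ (s - 1)) z) = ENNReal.ofReal (2 ^ n) *
        lqNorm s' (ballAvg s' (2 * τ) (fun x => A x ^ (s - 1))) := by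
      simp only [lqNorm]
      simp only [ENNReal.mul_rpow_of_nonneg _ _ hs'0.le]
      rw [lintegral_const_mul' _ _ (by finiteness), ENNReal.mul_rpow_of_nonneg _ _ (by positivity),
        ← ENNReal.rpow_mul, mul_one_div_cancel hs'0.ne', ENNReal.rpow_one]
    rw [hconst, lqNorm_ballAvg_self hs'0 (by positivity) (hAm.pow_const _), lqNorm]
    congr 3
    ext x
    rw [← ENNReal.rpow_mul, hs.sub_one_mul_conj]

lemma lqNorm_ballAvg_le_of_forall_lintegral_mul_le {r r' s s' τ : ℝ} (hr : r.HolderConjugate r')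
    (hs : s.HolderConjugate s') (hτ : 0 < τ) {G : (Fin n → ℝ) → ℝ≥0∞} (hG : Measurable G)
    {K : ℝ≥0∞} (hK : ∀ h : (Fin n → ℝ) → ℝ≥0∞, Measurable h →
      ∫⁻ x, G x * h x ≤ K * lqNorm s' (ballAvg r' τ h)) :
    lqNorm s (ballAvg r τ G) ≤ ENNReal.ofReal (2 ^ n) * K := by
  have hr0 := hr.pos
  have hs0 := hs.pos
  set g : ℕ → (Fin n → ℝ) → ℝ≥0∞ := fun N =>
    (closedBall 0 (N : ℝ)).indicator fun y => min (G y) N with hg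
  have hgm : ∀ N, Measurable (g N) := fun N =>
    (hG.min measurable_const).indicator measurableSet_closedBall
  have hgmono : Monotone g := by
    intro N M h y
    have hsub : closedBall (0 : Fin n → ℝ) (N : ℝ) ⊆ closedBall 0 (M : ℝ) :=
      closedBall_subset_closedBall (Nat.cast_le.2 h)
    refine (indicator_le_indicator_of_subset hsub (fun _ => zero_le) y).trans ?_
    exact indicator_le_indicator (min_le_min_left _ (Nat.cast_le.2 h))
  have hgG : ∀ N y, g N y ≤ G y := fun N y =>
    (indicator_le_self _ _ y).trans (min_le_left _ _)
  have hsup : G = fun y => ⨆ N, g N y := by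
    ext y
    refine le_antisymm ?_ (iSup_le fun N => hgG N y)
    refine le_of_forall_lt fun c hc => ?_
    obtain ⟨N₁, h₁⟩ := exists_nat_gt c.toReal
    obtain ⟨N₂, h₂⟩ := exists_nat_ge (dist y 0)
    have hct : c ≠ ∞ := (hc.trans_le le_top).ne
    refine lt_of_lt_of_le ?_ (le_iSup (fun N => g N y) (max N₁ N₂))
    have hy : y ∈ closedBall (0 : Fin n → ℝ) ((max N₁ N₂ : ℕ) : ℝ) :=
      mem_closedBall.2 (h₂.trans (by exact_mod_cast le_max_right _ _))
    simp only [hg, indicator_of_mem hy]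
    refine lt_min hc ?_
    rw [← ENNReal.ofReal_toReal hct, ← ENNReal.ofReal_natCast]
    exact (ENNReal.ofReal_lt_ofReal_iff (by
      have := ENNReal.toReal_nonneg (a := c)
      have h3 : (N₁ : ℝ) ≤ ((max N₁ N₂ : ℕ) : ℝ) := by exact_mod_cast le_max_left _ _
      linarith)).2 (h₁.trans_le (by exact_mod_cast le_max_left _ _))
  have hN : ∀ N, lqNorm s (ballAvg r τ (g N)) ≤ ENNReal.ofReal (2 ^ n) * K := by
    intro N
    have hle : ∀ z, ballAvg r τ (g N) z ≤ N := by
      intro z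
      refine (ballAvg_mono hr0 (g := fun _ => (N : ℝ≥0∞)) (fun y =>
        (indicator_le_self _ _ y).trans (min_le_right _ _)) z).trans_eq ?_
      rw [ballAvg, setLIntegral_const, volume_closedBall_eq_ballVol _ hτ.le, mul_comm, mul_assoc,
        ENNReal.mul_inv_cancel (ballVol_ne_zero hτ) ballVol_ne_top, mul_one, ← ENNReal.rpow_mul,
        mul_one_div_cancel hr0.ne', ENNReal.rpow_one]
    have hzero : ∀ z, z ∉ closedBall (0 : Fin n → ℝ) (N + τ) → ballAvg r τ (g N) z = 0 := by
      intro z hz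
      have : ∫⁻ y in closedBall z τ, g N y ^ r = 0 := by
        rw [setLIntegral_congr_fun (g := fun _ => 0) measurableSet_closedBall, lintegral_zero]
        intro y hy
        have : y ∉ closedBall (0 : Fin n → ℝ) (N : ℝ) := by
          intro hy0
          apply hz
          rw [mem_closedBall] at *
          have := dist_triangle z y 0
          rw [dist_comm z y] at this
          linarith
        simp [hg, indicator_of_notMem this, hr0]
      rw [ballAvg, this, mul_zero, ENNReal.zero_rpow_of_pos (by positivity)]
    have hfin : ∫⁻ z, ballAvg r τ (g N) z ^ s ≠ ∞ := by
      refine ne_top_of_le_ne_top (b := ∫⁻ z,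
        (closedBall (0 : Fin n → ℝ) (N + τ)).indicator (fun _ => (N : ℝ≥0∞) ^ s) z) ?_ ?_
      · rw [lintegral_indicator measurableSet_closedBall, setLIntegral_const]
        exact ENNReal.mul_ne_top (by finiteness) measure_closedBall_lt_top.ne
      · refine lintegral_mono fun z => ?_
        by_cases hz : z ∈ closedBall (0 : Fin n → ℝ) (N + τ)
        · rw [indicator_of_mem hz]
          exact ENNReal.rpow_le_rpow (hle z) hs0.le
        · simp [hzero z hz, hs0]
    obtain ⟨h, hhm, hI, hb⟩ := exists_dual_function hr hs hτ (hgm N)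
      (fun z => ne_top_of_le_ne_top (by finiteness) (hle z))
    set S := ∫⁻ z, ballAvg r τ (g N) z ^ s
    have hS : S ≤ ENNReal.ofReal (2 ^ n) * K * S ^ (1 / s') := by
      calc S = ∫⁻ y, g N y * h y := hI.symm
        _ ≤ ∫⁻ y, G y * h y := lintegral_mono fun y => mul_le_mul_left (hgG N y) _
        _ ≤ _ := hK h hhm
        _ ≤ _ := mul_le_mul_right hb K
        _ = _ := by ring
    change S ^ (1 / s) ≤ _
    by_cases hS0 : S = 0
    · rw [hS0, ENNReal.zero_rpow_of_pos (by positivity)]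
      exact zero_le
    · have hs'0 := hs.symm.pos
      have e0 : S ^ (1 / s') ≠ 0 := (ENNReal.rpow_pos (pos_iff_ne_zero.2 hS0) hfin).ne'
      have e1 : S ^ (1 / s') ≠ ∞ := ENNReal.rpow_ne_top_of_nonneg (by positivity) hfin
      refine (ENNReal.mul_le_mul_iff_left e0 e1).1 (le_trans (le_of_eq ?_) hS)
      rw [← ENNReal.rpow_add _ _ hS0 hfin, one_div, one_div, hs.inv_add_inv_eq_one,
        ENNReal.rpow_one]
  have hAm : ∀ N, Measurable (ballAvg r τ (g N)) := fun N =>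
    measurable_ballAvg r (hgm N) measurable_id measurable_const
  have hfun : ballAvg r τ G = fun z => ⨆ N, ballAvg r τ (g N) z := by
    ext z
    conv_lhs => rw [hsup]
    exact ballAvg_iSup hr0 τ hgm hgmono z
  rw [hfun, lqNorm_iSup hs0 hAm fun N M h z => ballAvg_mono hr0 (hgmono h) z]
  exact iSup_le hN

end SliceDuality

section SupNormEstimates

open Set Filter Topology

variable {n : ℕ}

lemma exists_lqNorm_riesz_le (hn : n ≠ 0) {α p q r r' s s' u : ℝ} (hα : 0 < α) (hαn : α < n)
    (hpr : α / n = 1 / p - 1 / r) (hqs : α / n = 1 / q - 1 / s) (hr : r.HolderConjugate r')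
    (hs : s.HolderConjugate s') (hu : 0 < u) (hup : u < p) (huq : u < q) (hur : u < r')
    (hus : u < s') : ∃ C : ℝ≥0∞, C ≠ ∞ ∧ ∀ (D : (Fin n → ℝ) → (Fin n → ℝ) → ℝ≥0∞) (B : ℝ≥0∞),
      Measurable (Function.uncurry D) → ScaleBound D u B → ∀ τ, 0 < τ →
        ∀ f : (Fin n → ℝ) → ℝ≥0∞, Measurable f →
          lqNorm s (ballAvg r τ fun x => ∫⁻ y, D x y * ENNReal.ofReal (dist x y ^ (α - n)) * f y) ≤
            C * B * lqNorm q (ballAvg p τ f) := by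
  obtain ⟨C, hC, hform⟩ := exists_slice_form_le hn hα hpr hqs hr hs hu hup huq hur hus
  refine ⟨ENNReal.ofReal (2 ^ n) * (ENNReal.ofReal (4 ^ n * 2 ^ (n + 1 - α)) * C), by finiteness, ?_⟩
  intro D B hD hDB τ hτ f hf
  have hker : Measurable fun a : (Fin n → ℝ) × (Fin n → ℝ) =>
      D a.1 a.2 * ENNReal.ofReal (dist a.1 a.2 ^ (α - n)) * f a.2 :=
    (hD.mul (by fun_prop)).mul (hf.comp measurable_snd)
  have hG : Measurable fun x => ∫⁻ y, D x y * ENNReal.ofReal (dist x y ^ (α - n)) * f y :=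
    hker.lintegral_prod_right'
  refine (lqNorm_ballAvg_le_of_forall_lintegral_mul_le hr hs hτ hG
    (K := ENNReal.ofReal (4 ^ n * 2 ^ (n + 1 - α)) * B * (C * lqNorm q (ballAvg p τ f)))
    fun h hh => ?_).trans_eq (by ring)
  have h1 : ∀ x, (∫⁻ y, D x y * ENNReal.ofReal (dist x y ^ (α - n)) * f y) * h x =
      ∫⁻ y, D x y * ENNReal.ofReal (dist x y ^ (α - n)) * f y * h x := fun x =>
    (lintegral_mul_const _ (hker.comp (measurable_const.prodMk measurable_id))).symm
  simp only [h1]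
  refine (lintegral_mul_rieszKernel_le hαn hD hDB hf hh).trans ?_
  rw [mul_assoc _ (C * _)]
  exact mul_le_mul_right (hform τ hτ f h hf hh) _

lemma lintegral_lintegral_closedBall_mul {f h : (Fin n → ℝ) → ℝ≥0∞} (hf : Measurable f)
    (hh : Measurable h) (z : Fin n → ℝ) (R : ℝ) :
    ∫⁻ x in closedBall z R, ∫⁻ y in closedBall z R, f y * h x =
      (∫⁻ y in closedBall z R, f y) * ∫⁻ x in closedBall z R, h x := by
  rw [← lintegral_const_mul _ hh]
  exact lintegral_congr fun x => lintegral_mul_const _ hf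

lemma scaleBound_one {u : ℝ} (hu : 1 ≤ u) :
    ScaleBound (fun _ _ : Fin n → ℝ => 1) u 1 := by
  intro f h hf hh z R hR
  simp only [one_mul]
  rw [lintegral_lintegral_closedBall_mul hf hh]
  exact mul_le_mul' (setLIntegral_le_ballAvg hu hR hf z) (setLIntegral_le_ballAvg hu hR hh z)

lemma exists_scaleBound_enorm_sub (n : ℕ) {u : ℝ} (hu : 1 < u) : ∃ C : ℝ≥0∞, C ≠ ∞ ∧
    ∀ b : (Fin n → ℝ) → ℝ, Measurable b → LocallyIntegrable b → ∀ N, MeanOscLE b N → N ≠ ∞ →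
      ScaleBound (fun x y => ‖b x - b y‖ₑ) u (C * N) := by
  have huv := Real.HolderConjugate.conjExponent hu
  set v := u.conjExponent
  have hv0 := huv.symm.pos
  obtain ⟨m, hm⟩ := exists_nat_ge v
  have hm0 : m ≠ 0 := by
    rintro rfl
    simp only [Nat.cast_zero] at hm
    linarith
  obtain ⟨C, hC, hosc⟩ := exists_ballAvg_osc_le n hm0
  refine ⟨2 * C, by finiteness, fun b hb hbl N hN hNt f h hf hh z R hR => ?_⟩
  set a := ⨍ w in closedBall z R, b w
  have hbm : Measurable fun y => ‖b y - a‖ₑ := by fun_prop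
  have hosc' : ballAvg v R (fun y => ‖b y - a‖ₑ) z ≤ C * N :=
    (ballAvg_mono_exponent hv0 hm hR hbm z).trans (hosc b hb hbl N hN hNt z R hR)
  have key : ∀ g : (Fin n → ℝ) → ℝ≥0∞, Measurable g →
      ∫⁻ y in closedBall z R, g y * ‖b y - a‖ₑ ≤ ballVol n R * ballAvg u R g z * (C * N) :=
    fun g hg => (setLIntegral_mul_le_ballAvg huv hR hg hbm z).trans (mul_le_mul_right hosc' _)
  have hpt : ∀ x y, ‖b x - b y‖ₑ * f y * h x ≤
      f y * (h x * ‖b x - a‖ₑ) + f y * ‖b y - a‖ₑ * h x := by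
    intro x y
    have : ‖b x - b y‖ₑ ≤ ‖b x - a‖ₑ + ‖b y - a‖ₑ := by
      have h1 := enorm_sub_le (E := ℝ) (a := b x - a) (b := b y - a)
      simpa using h1
    calc ‖b x - b y‖ₑ * f y * h x ≤ (‖b x - a‖ₑ + ‖b y - a‖ₑ) * f y * h x := by gcongr
      _ = _ := by ring
  have hfb : Measurable fun y => f y * ‖b y - a‖ₑ := hf.mul hbm
  have hhb : Measurable fun y => h y * ‖b y - a‖ₑ := hh.mul hbm
  have hm1 : Measurable fun x => ∫⁻ y in closedBall z R, f y * (h x * ‖b x - a‖ₑ) := by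
    have : ∀ x, ∫⁻ y in closedBall z R, f y * (h x * ‖b x - a‖ₑ) =
        (∫⁻ y in closedBall z R, f y) * (h x * ‖b x - a‖ₑ) := fun x => lintegral_mul_const _ hf
    simp only [this]
    exact hhb.const_mul _
  calc ∫⁻ x in closedBall z R, ∫⁻ y in closedBall z R, ‖b x - b y‖ₑ * f y * h x
      ≤ ∫⁻ x in closedBall z R, ∫⁻ y in closedBall z R,
          (f y * (h x * ‖b x - a‖ₑ) + f y * ‖b y - a‖ₑ * h x) :=
        lintegral_mono fun x => lintegral_mono fun y => hpt x y
    _ = (∫⁻ x in closedBall z R, ∫⁻ y in closedBall z R, f y * (h x * ‖b x - a‖ₑ)) +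
          ∫⁻ x in closedBall z R, ∫⁻ y in closedBall z R, f y * ‖b y - a‖ₑ * h x := by
        rw [← lintegral_add_left hm1]
        exact lintegral_congr fun x => lintegral_add_left (hf.mul_const _) _
    _ = (∫⁻ y in closedBall z R, f y) * (∫⁻ x in closedBall z R, h x * ‖b x - a‖ₑ) +
          (∫⁻ y in closedBall z R, f y * ‖b y - a‖ₑ) * ∫⁻ x in closedBall z R, h x := by
        rw [lintegral_lintegral_closedBall_mul hf hhb, lintegral_lintegral_closedBall_mul hfb hh]
    _ ≤ (ballVol n R * ballAvg u R f z) * (ballVol n R * ballAvg u R h z * (C * N)) +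
          (ballVol n R * ballAvg u R f z * (C * N)) * (ballVol n R * ballAvg u R h z) :=
        add_le_add
          (mul_le_mul' (setLIntegral_le_ballAvg hu.le hR hf z) (key h hh))
          (mul_le_mul' (key f hf) (setLIntegral_le_ballAvg hu.le hR hh z))
    _ = _ := by ring

/-- The bounds for the fractional integral operator and for the positive commutator between slice
norms, on `Fin n → ℝ` with the sup norm. -/
lemma exists_lqNorm_commutator_le (hn : n ≠ 0) {α p q r s : ℝ} (hα : 0 < α) (hαn : α < n)
    (hp : 1 < p) (hpr : p < r) (hq : 1 < q) (hqs : q < s) (hpr' : α / n = 1 / p - 1 / r)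
    (hqs' : α / n = 1 / q - 1 / s) : ∃ C : ℝ≥0∞, C ≠ ∞ ∧ ∀ τ, 0 < τ →
      ∀ f : (Fin n → ℝ) → ℝ≥0∞, Measurable f →
        lqNorm s (ballAvg r τ fun x => ∫⁻ y, ENNReal.ofReal (dist x y ^ (α - n)) * f y) ≤
            C * lqNorm q (ballAvg p τ f) ∧
        ∀ b : (Fin n → ℝ) → ℝ, Measurable b → LocallyIntegrable b → ∀ N, MeanOscLE b N → N ≠ ∞ →
          lqNorm s (ballAvg r τ fun x =>
            ∫⁻ y, ‖b x - b y‖ₑ * ENNReal.ofReal (dist x y ^ (α - n)) * f y) ≤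
            C * N * lqNorm q (ballAvg p τ f) := by
  have hr := Real.HolderConjugate.conjExponent (hp.trans hpr)
  have hs := Real.HolderConjugate.conjExponent (hq.trans hqs)
  obtain ⟨u, hu1, hu⟩ := exists_between
    (lt_min (lt_min hp hq) (lt_min hr.symm.lt hs.symm.lt))
  simp only [lt_min_iff] at hu
  obtain ⟨⟨hup, huq⟩, hur, hus⟩ := hu
  obtain ⟨C₁, hC₁, hmain⟩ := exists_lqNorm_riesz_le hn hα hαn hpr' hqs' hr hs
    (zero_lt_one.trans hu1) hup huq hur hus
  obtain ⟨C₂, hC₂, hsb⟩ := exists_scaleBound_enorm_sub n hu1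
  refine ⟨C₁ + C₁ * C₂, by finiteness, fun τ hτ f hf => ⟨?_, fun b hb hbl N hN hNt => ?_⟩⟩
  · have := hmain _ _ measurable_const (scaleBound_one hu1.le) τ hτ f hf
    simp only [one_mul, mul_one] at this
    exact this.trans (mul_le_mul_left le_self_add _)
  · have hD : Measurable (Function.uncurry fun x y : Fin n → ℝ => ‖b x - b y‖ₑ) :=
      ((hb.comp measurable_fst).sub (hb.comp measurable_snd)).enorm
    refine (hmain _ _ hD (hsb b hb hbl N hN hNt) τ hτ f hf).trans ?_
    rw [← mul_assoc]
    exact mul_le_mul_left (mul_le_mul_left le_add_self _) _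

end SupNormEstimates

section Transport

open Set Filter Topology

variable {n : ℕ}

lemma measurableEmbedding_ofLp :
    MeasurableEmbedding (WithLp.ofLp : EuclideanSpace ℝ (Fin n) → Fin n → ℝ) :=
  (MeasurableEquiv.toLp 2 (Fin n → ℝ)).symm.measurableEmbedding

lemma measurable_toLp :
    Measurable (WithLp.toLp 2 : (Fin n → ℝ) → EuclideanSpace ℝ (Fin n)) :=
  (PiLp.volume_preserving_toLp (Fin n)).measurable

lemma cube_eq_preimage {t : ℝ} (ht : 0 ≤ t) (x : EuclideanSpace ℝ (Fin n)) :
    cube x t = WithLp.ofLp ⁻¹' closedBall (WithLp.ofLp x) (t / 2) := by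
  ext y
  rw [mem_preimage, mem_closedBall, dist_pi_le_iff (by positivity)]
  rfl

lemma volume_cube {t : ℝ} (ht : 0 ≤ t) (x : EuclideanSpace ℝ (Fin n)) :
    volume (cube x t) = ballVol n (t / 2) := by
  rw [cube_eq_preimage ht, (PiLp.volume_preserving_ofLp (Fin n)).measure_preimage
    measurableSet_closedBall.nullMeasurableSet, volume_closedBall_eq_ballVol _ (by positivity)]

lemma setLIntegral_cube {t : ℝ} (ht : 0 ≤ t) (x : EuclideanSpace ℝ (Fin n))
    (g : EuclideanSpace ℝ (Fin n) → ℝ≥0∞) :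
    ∫⁻ y in cube x t, g y = ∫⁻ y in closedBall (WithLp.ofLp x) (t / 2), g (WithLp.toLp 2 y) := by
  rw [cube_eq_preimage ht]
  exact (PiLp.volume_preserving_ofLp (Fin n)).setLIntegral_comp_preimage_emb
    measurableEmbedding_ofLp (fun y => g (WithLp.toLp 2 y)) _

lemma setAvg_cube {t : ℝ} (ht : 0 ≤ t) (x : EuclideanSpace ℝ (Fin n))
    (g : EuclideanSpace ℝ (Fin n) → ℝ) :
    setAvg (cube x t) g = ⨍ y in closedBall (WithLp.ofLp x) (t / 2), g (WithLp.toLp 2 y) := by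
  rw [setAvg, volume_cube ht, setAverage_eq, Measure.real,
    volume_closedBall_eq_ballVol _ (by positivity), smul_eq_mul, cube_eq_preimage ht]
  congr 1
  exact (PiLp.volume_preserving_ofLp (Fin n)).setIntegral_preimage_emb
    measurableEmbedding_ofLp (fun y => g (WithLp.toLp 2 y)) _

lemma sliceNormE_eq_lqNorm {p q t : ℝ} (ht : 0 ≤ t)
    (g : EuclideanSpace ℝ (Fin n) → ℝ≥0∞) :
    sliceNormE p q t g = lqNorm q (ballAvg p (t / 2) fun y => g (WithLp.toLp 2 y)) := by
  rw [sliceNormE, lqNorm]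
  congr 1
  rw [← (PiLp.volume_preserving_ofLp (Fin n)).lintegral_comp_emb measurableEmbedding_ofLp]
  refine lintegral_congr fun x => ?_
  rw [ballAvg, ← ENNReal.rpow_mul, volume_cube ht, setLIntegral_cube ht]
  ring_nf

lemma sliceNormE_mono_ae {p q t : ℝ} (hp : 0 < p) (hq : 0 < q)
    {g₁ g₂ : EuclideanSpace ℝ (Fin n) → ℝ≥0∞} (h : g₁ ≤ᵐ[volume] g₂) :
    sliceNormE p q t g₁ ≤ sliceNormE p q t g₂ := by
  refine ENNReal.rpow_le_rpow (lintegral_mono fun x => ENNReal.rpow_le_rpow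
    (mul_le_mul_right (lintegral_mono_ae ?_) _) (by positivity)) (by positivity)
  filter_upwards [ae_restrict_of_ae h] with y hy
  exact ENNReal.rpow_le_rpow hy hp.le

lemma meanOscLE_bmoNorm (b : EuclideanSpace ℝ (Fin n) → ℝ) :
    MeanOscLE (fun y => b (WithLp.toLp 2 y)) (bmoNorm b) := by
  intro z R hR
  have hRR : 0 < 2 * R := by positivity
  have h : (volume (cube (WithLp.toLp 2 z) (2 * R)))⁻¹ * ∫⁻ y in cube (WithLp.toLp 2 z) (2 * R),
      ENNReal.ofReal |b y - setAvg (cube (WithLp.toLp 2 z) (2 * R)) b| ≤ bmoNorm b :=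
    le_iSup₂_of_le (WithLp.toLp 2 z) (2 * R) (le_iSup_of_le hRR le_rfl)
  rw [volume_cube hRR.le, setAvg_cube hRR.le, setLIntegral_cube hRR.le,
    mul_div_cancel_left₀ R two_ne_zero] at h
  simp only [Real.enorm_eq_ofReal_abs]
  calc _ = ballVol n R * ((ballVol n R)⁻¹ * ∫⁻ y in closedBall z R, ENNReal.ofReal
        |b (WithLp.toLp 2 y) - ⨍ w in closedBall z R, b (WithLp.toLp 2 w)|) := by
        rw [← mul_assoc, ENNReal.mul_inv_cancel (ballVol_ne_zero hR) ballVol_ne_top, one_mul]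
    _ ≤ ballVol n R * bmoNorm b := mul_le_mul_right h _
    _ = _ := mul_comm _ _

lemma MeanOscLE.congr_ae {b b' : (Fin n → ℝ) → ℝ} {N : ℝ≥0∞} (h : b =ᵐ[volume] b')
    (hb : MeanOscLE b N) : MeanOscLE b' N := by
  intro z R hR
  refine le_trans (le_of_eq ?_) (hb z R hR)
  have hr : b =ᵐ[volume.restrict (closedBall z R)] b' := ae_restrict_of_ae h
  rw [average_congr hr]
  refine lintegral_congr_ae ?_
  filter_upwards [hr] with y hy
  rw [hy]

lemma locallyIntegrable_comp_toLp {b : EuclideanSpace ℝ (Fin n) → ℝ}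
    (hb : LocallyIntegrable b volume) :
    LocallyIntegrable (fun y : Fin n → ℝ => b (WithLp.toLp 2 y)) volume := by
  rw [← (PiLp.volume_preserving_toLp (Fin n)).map_eq] at hb
  exact (locallyIntegrable_map_homeomorph
    (EuclideanSpace.equiv (Fin n) ℝ).symm.toHomeomorph).1 hb

lemma locallyIntegrable_of_congr_ae {b b' : (Fin n → ℝ) → ℝ} (hb : LocallyIntegrable b)
    (h : b =ᵐ[volume] b') : LocallyIntegrable b' := by
  intro x
  obtain ⟨U, hU, hbU⟩ := hb x
  exact ⟨U, hU, Integrable.congr hbU (ae_restrict_of_ae h)⟩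

lemma ae_lt_top_of_lqNorm_ballAvg_ne_top {r s τ : ℝ} (hr : 0 < r) (hs : 0 < s) (hτ : 0 < τ)
    {G : (Fin n → ℝ) → ℝ≥0∞} (hG : Measurable G) (h : lqNorm s (ballAvg r τ G) ≠ ∞) :
    ∀ᵐ x, G x < ∞ := by
  have hAm : Measurable (ballAvg r τ G) := measurable_ballAvg r hG measurable_id measurable_const
  have hT : MeasurableSet {x | G x = ∞} := hG (measurableSet_singleton ∞)
  have h1 : ∫⁻ z, ballAvg r τ G z ^ s ≠ ∞ := by
    rw [← lqNorm_rpow hs]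
    exact ENNReal.rpow_ne_top_of_nonneg hs.le h
  have h2 : ∀ᵐ z, ∫⁻ y in closedBall z τ, {x | G x = ∞}.indicator (fun _ => 1) y = (0 : ℝ≥0∞) := by
    filter_upwards [ae_lt_top (hAm.pow_const s) h1] with z hz
    have h3 : ballAvg r τ G z ≠ ∞ := fun h0 => by simp [h0, hs] at hz
    have h4 : ∫⁻ y in closedBall z τ, G y ^ r ≠ ∞ := by
      rw [setLIntegral_rpow_eq_ballAvg hr hτ]
      exact ENNReal.mul_ne_top ballVol_ne_top (ENNReal.rpow_ne_top_of_nonneg hr.le h3)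
    have h5 : ∀ᵐ y ∂volume.restrict (closedBall z τ),
        {x | G x = ∞}.indicator (fun _ => (1 : ℝ≥0∞)) y = 0 := by
      filter_upwards [ae_lt_top (hG.pow_const r) h4] with y hy
      refine indicator_of_notMem (fun h0 => ?_) _
      have h0' : G y = ∞ := h0
      simp [h0', hr] at hy
    rw [lintegral_congr_ae h5, lintegral_zero]
  have h6 := lintegral_setLIntegral_closedBall
    ((measurable_const (a := (1 : ℝ≥0∞))).indicator hT) hτ.le
  rw [lintegral_congr_ae h2, lintegral_zero, lintegral_indicator hT, setLIntegral_const, one_mul,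
    eq_comm, mul_eq_zero, or_iff_right (ballVol_ne_zero hτ)] at h6
  rw [ae_iff]
  simpa using h6

lemma lqNorm_ballAvg_const_mul {r s τ : ℝ} (hr : 0 < r) (hs : 0 < s) {c : ℝ≥0∞} (hc : c ≠ ∞)
    (G : (Fin n → ℝ) → ℝ≥0∞) :
    lqNorm s (ballAvg r τ fun x => c * G x) = c * lqNorm s (ballAvg r τ G) := by
  have h1 : ∀ z, ballAvg r τ (fun x => c * G x) z = c * ballAvg r τ G z := by
    intro z
    simp only [ballAvg, ENNReal.mul_rpow_of_nonneg _ _ hr.le]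
    rw [lintegral_const_mul' _ _ (by finiteness), mul_left_comm,
      ENNReal.mul_rpow_of_nonneg _ _ (by positivity), ← ENNReal.rpow_mul,
      mul_one_div_cancel hr.ne', ENNReal.rpow_one]
  simp only [lqNorm, h1, ENNReal.mul_rpow_of_nonneg _ _ hs.le]
  rw [lintegral_const_mul' _ _ (by finiteness), ENNReal.mul_rpow_of_nonneg _ _ (by positivity),
    ← ENNReal.rpow_mul, mul_one_div_cancel hs.ne', ENNReal.rpow_one]

end Transport

section RoughKernel

open Set Filter Topology

variable {n : ℕ}

lemma HomogZero.apply_eq {Ω : EuclideanSpace ℝ (Fin n) → ℝ} (h : HomogZero Ω)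
    {v : EuclideanSpace ℝ (Fin n)} (hv : v ≠ 0) : Ω v = Ω (‖v‖⁻¹ • v) :=
  (h _ (by positivity) v hv).symm

lemma inv_norm_smul_mem_sphere {v : EuclideanSpace ℝ (Fin n)} (hv : v ≠ 0) :
    ‖v‖⁻¹ • v ∈ sphere (0 : EuclideanSpace ℝ (Fin n)) 1 := by
  simp [norm_smul, hv]

lemma HomogZero.exists_abs_le {Ω : EuclideanSpace ℝ (Fin n) → ℝ} (h : HomogZero Ω)
    (hc : ContinuousOn Ω (sphere 0 1)) : ∃ M, 0 ≤ M ∧ ∀ v, v ≠ 0 → |Ω v| ≤ M := by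
  obtain ⟨M, hM⟩ := (isCompact_sphere (0 : EuclideanSpace ℝ (Fin n)) 1).exists_bound_of_continuousOn hc
  refine ⟨max M 0, le_max_right _ _, fun v hv => ?_⟩
  rw [h.apply_eq hv]
  exact (hM _ (inv_norm_smul_mem_sphere hv)).trans (le_max_left _ _)

lemma HomogZero.measurable {Ω : EuclideanSpace ℝ (Fin n) → ℝ} (h : HomogZero Ω)
    (hc : ContinuousOn Ω (sphere 0 1)) : Measurable Ω := by
  refine measurable_of_continuousOn_compl_singleton 0 ?_
  have h1 : ContinuousOn (fun v : EuclideanSpace ℝ (Fin n) => ‖v‖⁻¹ • v) {0}ᶜ :=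
    (continuousOn_id.norm.inv₀ fun v hv => norm_ne_zero_iff.2 hv).smul continuousOn_id
  exact (hc.comp h1 fun v hv => inv_norm_smul_mem_sphere hv).congr fun v hv => h.apply_eq hv

lemma norm_sub_rpow_le {e : ℝ} (he : e < 0) (x y : EuclideanSpace ℝ (Fin n)) :
    ‖x - y‖ ^ e ≤ dist (WithLp.ofLp x) (WithLp.ofLp y) ^ e := by
  by_cases hxy : x = y
  · simp [hxy]
  · have h0 : WithLp.ofLp x ≠ WithLp.ofLp y := fun h => hxy (WithLp.ofLp_injective 2 h)
    refine Real.rpow_le_rpow_of_nonpos (dist_pos.2 h0) ?_ he.le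
    rw [dist_pi_le_iff (norm_nonneg _)]
    intro i
    simpa [Real.dist_eq] using PiLp.norm_apply_le (x - y) i

lemma fracInt_congr_ae {Ω : EuclideanSpace ℝ (Fin n) → ℝ} {α : ℝ}
    {f g : EuclideanSpace ℝ (Fin n) → ℝ} (h : f =ᵐ[volume] g) (x : EuclideanSpace ℝ (Fin n)) :
    fracInt Ω α f x = fracInt Ω α g x := by
  refine integral_congr_ae ?_
  filter_upwards [h] with y hy
  rw [hy]

lemma commutatorOp_congr_ae {Ω : EuclideanSpace ℝ (Fin n) → ℝ} {α : ℝ}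
    {b b' f : EuclideanSpace ℝ (Fin n) → ℝ} (h : b =ᵐ[volume] b') :
    commutatorOp Ω α b f =ᵐ[volume] commutatorOp Ω α b' f := by
  have h1 : (fun y => b y * f y) =ᵐ[volume] fun y => b' y * f y := by
    filter_upwards [h] with y hy
    rw [hy]
  filter_upwards [h] with x hx
  rw [commutatorOp, commutatorOp, hx, fracInt_congr_ae h1]

/-- Pointwise domination of the commutator by the positive commutator with the Riesz kernel. -/
lemma enorm_commutatorOp_le {Ω b f : EuclideanSpace ℝ (Fin n) → ℝ} {α M : ℝ}
    (hα : α < n) (hM0 : 0 ≤ M) (hM : ∀ v, v ≠ 0 → |Ω v| ≤ M) (hΩ : Measurable Ω) (hb : Measurable b)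
    (hf : Measurable f) (x : EuclideanSpace ℝ (Fin n))
    (h1 : ∫⁻ y, ENNReal.ofReal (dist (WithLp.ofLp x) y ^ (α - n)) *
      ENNReal.ofReal |f (WithLp.toLp 2 y)| < ∞)
    (h2 : ∫⁻ y, ‖b x - b (WithLp.toLp 2 y)‖ₑ *
      ENNReal.ofReal (dist (WithLp.ofLp x) y ^ (α - n)) *
      ENNReal.ofReal |f (WithLp.toLp 2 y)| < ∞) :
    ENNReal.ofReal |commutatorOp Ω α b f x| ≤ ENNReal.ofReal M *
      ∫⁻ y, ‖b x - b (WithLp.toLp 2 y)‖ₑ *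
        ENNReal.ofReal (dist (WithLp.ofLp x) y ^ (α - n)) *
        ENNReal.ofReal |f (WithLp.toLp 2 y)| := by
  have hpres := PiLp.volume_preserving_ofLp (Fin n)
  have hk : ∀ y, ‖Ω (x - y) * ‖x - y‖ ^ (α - n)‖ₑ ≤
      ENNReal.ofReal M * ENNReal.ofReal (dist (WithLp.ofLp x) (WithLp.ofLp y) ^ (α - n)) := by
    intro y
    rw [Real.enorm_eq_ofReal_abs, ← ENNReal.ofReal_mul hM0]
    refine ENNReal.ofReal_le_ofReal ?_
    rw [abs_mul, abs_of_nonneg (Real.rpow_nonneg (norm_nonneg _) _)]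
    by_cases hxy : x = y
    · have : α - n ≠ 0 := by linarith
      simp [hxy, Real.zero_rpow this]
    · exact mul_le_mul (hM _ (sub_ne_zero.2 hxy)) (norm_sub_rpow_le (by linarith) x y)
        (Real.rpow_nonneg (norm_nonneg _) _) hM0
  have hkm : Measurable fun y => Ω (x - y) * ‖x - y‖ ^ (α - n) :=
    (hΩ.comp (measurable_const.sub measurable_id)).mul (by fun_prop)
  have b1 : ∫⁻ y, ‖Ω (x - y) * ‖x - y‖ ^ (α - n) * f y‖ₑ ≤ ENNReal.ofReal M *
      ∫⁻ y, ENNReal.ofReal (dist (WithLp.ofLp x) y ^ (α - n)) *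
        ENNReal.ofReal |f (WithLp.toLp 2 y)| := by
    rw [← hpres.lintegral_comp_emb measurableEmbedding_ofLp,
      ← lintegral_const_mul' _ _ (by finiteness)]
    refine lintegral_mono fun y => ?_
    rw [enorm_mul, ← mul_assoc, Real.enorm_eq_ofReal_abs (f y)]
    exact mul_le_mul_left (hk y) _
  have b2 : ∫⁻ y, ‖Ω (x - y) * ‖x - y‖ ^ (α - n) * ((b x - b y) * f y)‖ₑ ≤ ENNReal.ofReal M *
      ∫⁻ y, ‖b x - b (WithLp.toLp 2 y)‖ₑ *
        ENNReal.ofReal (dist (WithLp.ofLp x) y ^ (α - n)) *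
        ENNReal.ofReal |f (WithLp.toLp 2 y)| := by
    rw [← hpres.lintegral_comp_emb measurableEmbedding_ofLp,
      ← lintegral_const_mul' _ _ (by finiteness)]
    refine lintegral_mono fun y => ?_
    rw [enorm_mul, enorm_mul (b x - b y), Real.enorm_eq_ofReal_abs (f y)]
    refine (mul_le_mul_left (hk y) _).trans_eq ?_
    simp only [WithLp.toLp_ofLp]
    ring
  have i1 : Integrable fun y => Ω (x - y) * ‖x - y‖ ^ (α - n) * f y :=
    ⟨(hkm.mul hf).aestronglyMeasurable,
      b1.trans_lt (ENNReal.mul_lt_top ENNReal.ofReal_lt_top h1)⟩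
  have i2 : Integrable fun y => Ω (x - y) * ‖x - y‖ ^ (α - n) * ((b x - b y) * f y) :=
    ⟨(hkm.mul ((measurable_const.sub hb).mul hf)).aestronglyMeasurable,
      b2.trans_lt (ENNReal.mul_lt_top ENNReal.ofReal_lt_top h2)⟩
  have e : commutatorOp Ω α b f x =
      ∫ y, Ω (x - y) * ‖x - y‖ ^ (α - n) * ((b x - b y) * f y) := by
    have i3 := i1.const_mul (b x)
    have h3 : ∀ y, Ω (x - y) * ‖x - y‖ ^ (α - n) * (b y * f y) =
        b x * (Ω (x - y) * ‖x - y‖ ^ (α - n) * f y) -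
          Ω (x - y) * ‖x - y‖ ^ (α - n) * ((b x - b y) * f y) := fun y => by ring
    rw [commutatorOp, fracInt, fracInt]
    simp only [h3]
    rw [integral_sub i3 i2, integral_const_mul]
    ring
  rw [← Real.enorm_eq_ofReal_abs, e]
  exact (enorm_integral_le_lintegral_enorm _).trans b2

end RoughKernel

theorem statement0 (n : ℕ) (hn : 1 ≤ n) (α : ℝ) (hα0 : 0 < α) (hαn : α < n)
    (p q r s : ℝ) (hp1 : 1 < p) (hpr : p < r) (hq1 : 1 < q) (hqs : q < s)
    (hpr' : α / n = 1 / p - 1 / r) (hqs' : α / n = 1 / q - 1 / s)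
    (Ω : EuclideanSpace ℝ (Fin n) → ℝ) (hhom : HomogZero Ω) (hmean : MeanZeroOnSphere Ω)
    (L : NNReal) (hlip : LipschitzOnWith L Ω (sphere (0 : EuclideanSpace ℝ (Fin n)) 1)) :
    ∃ C > (0 : ℝ), ∀ b : EuclideanSpace ℝ (Fin n) → ℝ, MemBMO b →
      ∀ t : ℝ, 0 < t → ∀ f : EuclideanSpace ℝ (Fin n) → ℝ, MemSlice p q t f →
        sliceNorm r s t (commutatorOp Ω α b f) ≤
          ENNReal.ofReal C * bmoNorm b * sliceNorm p q t f := by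


  have hn0 : n ≠ 0 := by omega
  have hp0 : 0 < p := by linarith
  have hr0 : 0 < r := by linarith
  have hs0 : 0 < s := by linarith
  obtain ⟨M, hM0, hM⟩ := hhom.exists_abs_le hlip.continuousOn
  have hΩ := hhom.measurable hlip.continuousOn
  obtain ⟨C, hC, hmain⟩ := exists_lqNorm_commutator_le hn0 hα0 hαn hp1 hpr hq1 hqs hpr' hqs'
  refine ⟨(ENNReal.ofReal M * C).toReal + 1, by positivity, fun b hb t ht f hf => ?_⟩
  have hCle : ENNReal.ofReal M * C ≤ ENNReal.ofReal ((ENNReal.ofReal M * C).toReal + 1) := by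
    refine (ENNReal.ofReal_toReal (by finiteness)).symm.trans_le (ENNReal.ofReal_le_ofReal ?_)
    linarith
  obtain ⟨hbl, hbN⟩ := hb
  obtain ⟨hfm, hffin⟩ := hf
  set b' := hbl.aestronglyMeasurable.mk b
  have hb'm : Measurable b' := hbl.aestronglyMeasurable.stronglyMeasurable_mk.measurable
  have hbb' : b =ᵐ[volume] b' := hbl.aestronglyMeasurable.ae_eq_mk
  have hBae : (fun y : Fin n → ℝ => b (WithLp.toLp 2 y)) =ᵐ[volume]
      fun y => b' (WithLp.toLp 2 y) :=
    (PiLp.volume_preserving_toLp (Fin n)).quasiMeasurePreserving.ae_eq_comp hbb'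
  have hBm : Measurable fun y : Fin n → ℝ => b' (WithLp.toLp 2 y) := hb'm.comp measurable_toLp
  have hBl := locallyIntegrable_of_congr_ae (locallyIntegrable_comp_toLp hbl) hBae
  have hBN := (meanOscLE_bmoNorm b).congr_ae hBae
  have hFm : Measurable fun y : Fin n → ℝ => ENNReal.ofReal |f (WithLp.toLp 2 y)| :=
    (measurable_abs.comp (hfm.comp measurable_toLp)).ennreal_ofReal
  have ht2 : 0 < t / 2 := by positivity
  obtain ⟨hI, hJ⟩ := hmain (t / 2) ht2 _ hFm
  replace hJ := hJ _ hBm hBl _ hBN hbN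
  have hfE : sliceNorm p q t f =
      lqNorm q (ballAvg p (t / 2) fun y => ENNReal.ofReal |f (WithLp.toLp 2 y)|) :=
    sliceNormE_eq_lqNorm ht.le _
  rw [← hfE] at hI hJ
  have hIm : Measurable fun x : Fin n → ℝ => ∫⁻ y, ENNReal.ofReal (dist x y ^ (α - n)) *
      ENNReal.ofReal |f (WithLp.toLp 2 y)| := by
    refine Measurable.lintegral_prod_right' (f := fun a : (Fin n → ℝ) × (Fin n → ℝ) =>
      ENNReal.ofReal (dist a.1 a.2 ^ (α - n)) * ENNReal.ofReal |f (WithLp.toLp 2 a.2)|) ?_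
    exact Measurable.mul (by fun_prop) (hFm.comp measurable_snd)
  have hJm : Measurable fun x : Fin n → ℝ => ∫⁻ y,
      ‖b' (WithLp.toLp 2 x) - b' (WithLp.toLp 2 y)‖ₑ * ENNReal.ofReal (dist x y ^ (α - n)) *
        ENNReal.ofReal |f (WithLp.toLp 2 y)| := by
    refine Measurable.lintegral_prod_right' (f := fun a : (Fin n → ℝ) × (Fin n → ℝ) =>
      ‖b' (WithLp.toLp 2 a.1) - b' (WithLp.toLp 2 a.2)‖ₑ * ENNReal.ofReal (dist a.1 a.2 ^ (α - n)) *
        ENNReal.ofReal |f (WithLp.toLp 2 a.2)|) ?_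
    exact Measurable.mul (Measurable.mul ((hBm.comp measurable_fst).sub
      (hBm.comp measurable_snd)).enorm (by fun_prop)) (hFm.comp measurable_snd)
  have hIae := ae_lt_top_of_lqNorm_ballAvg_ne_top hr0 hs0 ht2 hIm
    (ne_top_of_le_ne_top (by finiteness) hI)
  have hJae := ae_lt_top_of_lqNorm_ballAvg_ne_top hr0 hs0 ht2 hJm
    (ne_top_of_le_ne_top (by finiteness) hJ)
  have hpres := (PiLp.volume_preserving_ofLp (Fin n)).quasiMeasurePreserving
  have hdom : (fun x => ENNReal.ofReal |commutatorOp Ω α b f x|) ≤ᵐ[volume] fun x =>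
      ENNReal.ofReal M * ∫⁻ y, ‖b' x - b' (WithLp.toLp 2 y)‖ₑ *
        ENNReal.ofReal (dist (WithLp.ofLp x) y ^ (α - n)) *
        ENNReal.ofReal |f (WithLp.toLp 2 y)| := by
    filter_upwards [hpres.ae hIae, hpres.ae hJae, commutatorOp_congr_ae hbb'] with x hx1 hx2 hx3
    rw [hx3]
    exact enorm_commutatorOp_le hαn hM0 hM hΩ hb'm hfm x hx1 hx2
  calc sliceNorm r s t (commutatorOp Ω α b f)
      ≤ ENNReal.ofReal M * (C * bmoNorm b * sliceNorm p q t f) := by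
        refine (sliceNormE_mono_ae hr0 hs0 hdom).trans ?_
        rw [sliceNormE_eq_lqNorm ht.le, lqNorm_ballAvg_const_mul hr0 hs0 ENNReal.ofReal_ne_top]
        exact mul_le_mul_right hJ _
    _ = ENNReal.ofReal M * C * bmoNorm b * sliceNorm p q t f := by ring
    _ ≤ _ := by gcongr

end
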